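/- (Rivoal) Let z be a rational number with |z| > 1 and let ε > 0. Then there exists an integer ℓ₀ (depending on z and ε) such that for every integer ℓ ≥ ℓ₀, the dimension of the ℚ-vector space spanned by 1, Li₁(1/z), Li₂(1/z), …, Li_ℓ(1/z) is at least ((1−ε)/(1+log 2))·log ℓ. In particular, for every rational z with |z| > 1 there are infinitely many integers j such that Li_j(1/z) is irrational. -/

import Mathlib

/-- The polylogarithm `Li_k(x) = ∑_{n ≥ 1} x^n / n^k`. -/
noncomputable def Li (k : ℕ) (x : ℝ) : ℝ := ∑' n : ℕ, x ^ (n + 1) / (n + 1 : ℝ) ^ k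

/-- Simultaneous approximation of real numbers by integers with a common multiplier. -/
lemma exists_simultaneous_approx {ι : Type*} [Fintype ι] (v : ι → ℝ) (M : ℕ) (hM : 0 < M) :
    ∃ q : ℕ, 1 ≤ q ∧ q ≤ M ^ Fintype.card ι ∧ ∃ p : ι → ℤ, ∀ i, |q * v i - p i| ≤ 1 / M := by
  classical
  have hM' : (0 : ℝ) < M := by exact_mod_cast hM
  have hlt (x : ℝ) : ⌊M * Int.fract x⌋₊ < M := by
    rw [Nat.floor_lt (by positivity)]
    nlinarith [Int.fract_lt_one x]
  let f : ℕ → (ι → Fin M) := fun q i => ⟨⌊M * Int.fract (q * v i)⌋₊, hlt _⟩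
  obtain ⟨x, hx, y, hy, hxy, hf⟩ := Finset.exists_ne_map_eq_of_card_lt_of_maps_to
    (s := Finset.range (M ^ Fintype.card ι + 1)) (t := Finset.univ) (f := f)
    (by simp) (fun _ _ => by simp)
  wlog hlt' : x < y generalizing x y
  · exact this y hy x hx hxy.symm hf.symm (by omega)
  rw [Finset.mem_range] at hx hy
  refine ⟨y - x, by omega, by omega, fun i => ⌊y * v i⌋ - ⌊x * v i⌋, fun i => ?_⟩
  have h : ⌊M * Int.fract (x * v i)⌋₊ = ⌊M * Int.fract (y * v i)⌋₊ := by
    simpa [f] using congrFun hf i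
  have h1 := Nat.floor_le (show (0 : ℝ) ≤ M * Int.fract (x * v i) by positivity)
  have h2 := Nat.lt_floor_add_one (M * Int.fract (x * v i) : ℝ)
  have h3 := Nat.floor_le (show (0 : ℝ) ≤ M * Int.fract (y * v i) by positivity)
  have h4 := Nat.lt_floor_add_one (M * Int.fract (y * v i) : ℝ)
  rw [h] at h1 h2
  have key : |M * (Int.fract (y * v i) - Int.fract (x * v i))| ≤ 1 := by
    rw [abs_le]; constructor <;> nlinarith
  rw [abs_mul, abs_of_pos hM', mul_comm] at key
  rw [le_div_iff₀ hM']
  refine le_of_eq_of_le ?_ key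
  simp only [Int.fract]
  push_cast [Nat.cast_sub hlt'.le]
  ring_nf

/-- A linear independence criterion: small non-vanishing integer linear forms in elements of a
finite-dimensional rational space of reals whose size does not decrease too abruptly bound the
dimension of the space from below. -/
theorem one_le_mul_pow_finrank_mul_linearForm {ι : Type*} [Fintype ι] (V : Submodule ℚ ℝ)
    [FiniteDimensional ℚ V] (θ : ι → ℝ) (hθ : ∀ j, θ j ∈ V) (A : ℕ → ι → ℤ) (L H : ℕ → ℝ)
    (hL : ∀ n, L n = ∑ j, A n j * θ j) (hL0 : ∀ n, L n ≠ 0)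
    (hA : ∀ n j, |(A n j : ℝ)| ≤ H n) (hH : Monotone H) (hH1 : ∀ n, 1 ≤ H n)
    {c ρ : ℝ} (hc : 0 < c) (hρ : 0 < ρ) (hρ1 : ρ ≤ 1)
    (hratio : ∀ n, c * ρ ^ n * |L n| ≤ |L (n + 1)|) :
    ∃ C : ℝ, 0 < C ∧ ∀ n, 1 ≤ C * (H n / ρ ^ n) ^ Module.finrank ℚ V * |L n| := by
  classical
  set D := Module.finrank ℚ V with hD
  let b := Module.finBasis ℚ V
  let v : Fin D → ℝ := fun i => (b i : ℝ)
  let x : ι → Fin D → ℚ := fun j i => b.repr ⟨θ j, hθ j⟩ i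
  have hx (j : ι) : θ j = ∑ i, (x j i : ℝ) * v i := by
    have h := congrArg (Subtype.val) (b.sum_repr ⟨θ j, hθ j⟩)
    simp only [Submodule.coe_sum, Submodule.coe_smul] at h
    rw [← h]
    exact Finset.sum_congr rfl fun i _ => by simp [x, v, Rat.smul_def]
  obtain ⟨B, hB, hBx⟩ : ∃ B : ℕ, 0 < B ∧ ∀ j i, ∃ y : ℤ, (B : ℝ) * x j i = y := by
    refine ⟨∏ j, ∏ i, (x j i).den, Finset.prod_pos fun j _ => Finset.prod_pos fun i _ =>
      (x j i).den_pos, fun j i => ?_⟩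
    have hdvd : (x j i).den ∣ ∏ j, ∏ i, (x j i).den :=
      (Finset.dvd_prod_of_mem (fun i => (x j i).den) (Finset.mem_univ i)).trans
        (Finset.dvd_prod_of_mem (fun j => ∏ i, (x j i).den) (Finset.mem_univ j))
    obtain ⟨m, hm⟩ := hdvd
    refine ⟨m * (x j i).num, ?_⟩
    rw [hm]
    have : ((x j i : ℚ) : ℝ) * ((x j i).den : ℝ) = (x j i).num := by
      exact_mod_cast Rat.mul_den_eq_num (x j i)
    push_cast
    rw [← this]; ring
  choose y hy using hBx
  let Y : ℝ := 1 + ∑ i, ∑ j, |(y j i : ℝ)|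
  have hY : 1 ≤ Y := by
    have : 0 ≤ ∑ i, ∑ j, |(y j i : ℝ)| := by positivity
    simp only [Y]; linarith
  have hB' : (1 : ℝ) ≤ B := by exact_mod_cast hB
  have hform (n : ℕ) : B * L n = ∑ i, (∑ j, (A n j : ℝ) * y j i) * v i := by
    rw [hL, Finset.mul_sum]
    simp_rw [hx, ← hy, Finset.sum_mul, Finset.mul_sum]
    rw [Finset.sum_comm]
    exact Finset.sum_congr rfl fun i _ => Finset.sum_congr rfl fun j _ => by ring
  have hcoef (n : ℕ) : ∑ i, |∑ j, (A n j : ℝ) * y j i| ≤ H n * Y := by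
    calc ∑ i, |∑ j, (A n j : ℝ) * y j i| ≤ ∑ i, ∑ j, H n * |(y j i : ℝ)| := by
          refine Finset.sum_le_sum fun i _ => (Finset.abs_sum_le_sum_abs _ _).trans ?_
          refine Finset.sum_le_sum fun j _ => ?_
          rw [abs_mul]
          exact mul_le_mul_of_nonneg_right (hA n j) (abs_nonneg _)
      _ = H n * (Y - 1) := by simp_rw [← Finset.mul_sum]; simp [Y]
      _ ≤ H n * Y := by
          have := hH1 n
          gcongr
          linarith
  let c' : ℝ := min (c / 2) (min |L 0| 1)
  have hc' : 0 < c' := lt_min (by positivity) (lt_min (abs_pos.2 (hL0 0)) one_pos)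
  have hc'1 : c' ≤ 1 := (min_le_right _ _).trans (min_le_right _ _)
  let C₁ : ℝ := 2 * Y / c'
  have hC₁ : 1 ≤ C₁ := by
    rw [le_div_iff₀ hc']; linarith
  refine ⟨2 * B * (2 * C₁) ^ D, by positivity, fun n₀ => ?_⟩
  have hρn (n : ℕ) : 0 < ρ ^ n := pow_pos hρ n
  set T := C₁ * (H n₀ / ρ ^ n₀) with hT
  have hT1 : 1 ≤ T := by
    have : 1 ≤ H n₀ / ρ ^ n₀ := by
      rw [le_div_iff₀ (hρn _), one_mul]
      exact (pow_le_one₀ hρ.le hρ1).trans (hH1 _)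
    nlinarith
  set M := ⌈T⌉₊ with hM
  have hTM : T ≤ M := Nat.le_ceil T
  have hM2 : (M : ℝ) ≤ 2 * T := by linarith [Nat.ceil_lt_add_one (show 0 ≤ T by linarith)]
  have hM0 : 0 < M := by
    have : (0 : ℝ) < M := by linarith
    exact_mod_cast this
  have hM0' : (0 : ℝ) < M := by exact_mod_cast hM0
  obtain ⟨q, hq1, hqM, p, hp⟩ := exists_simultaneous_approx v M hM0
  rw [Fintype.card_fin] at hqM
  have hq1' : (1 : ℝ) ≤ q := by exact_mod_cast hq1
  have hqM' : (q : ℝ) ≤ (M : ℝ) ^ D := by exact_mod_cast hqM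
  have main : 1 / 2 ≤ q * (B * |L n₀|) := by
    by_contra! hcon
    have hex : ∃ n, q * (B * |L n|) < 1 / 2 := ⟨n₀, hcon⟩
    set n := Nat.find hex with hn
    have hn1 : q * (B * |L n|) < 1 / 2 := Nat.find_spec hex
    have hnn₀ : n ≤ n₀ := Nat.find_min' hex hcon
    let X : ℤ := ∑ i, (∑ j, A n j * y j i) * p i
    have hX : |(X : ℝ) - q * (B * L n)| ≤ H n * Y / M := by
      have : (X : ℝ) - q * (B * L n) = ∑ i, (∑ j, (A n j : ℝ) * y j i) * (p i - q * v i) := by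
        rw [hform, Finset.mul_sum]
        simp only [X]
        push_cast
        rw [← Finset.sum_sub_distrib]
        exact Finset.sum_congr rfl fun i _ => by ring
      rw [this]
      calc _ ≤ ∑ i, |∑ j, (A n j : ℝ) * y j i| * (1 / M) := by
            refine (Finset.abs_sum_le_sum_abs _ _).trans (Finset.sum_le_sum fun i _ => ?_)
            rw [abs_mul, abs_sub_comm]
            exact mul_le_mul_of_nonneg_left (hp i) (abs_nonneg _)
        _ ≤ H n * Y * (1 / M) := by
            rw [← Finset.sum_mul]
            exact mul_le_mul_of_nonneg_right (hcoef n) (by positivity)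
        _ = _ := by ring
    have hlow : c' * ρ ^ n ≤ q * (B * |L n|) := by
      have hqB : 1 ≤ (q : ℝ) * B := one_le_mul_of_one_le_of_one_le hq1' hB'
      rcases Nat.eq_zero_or_pos n with h0 | h0
      · rw [h0, pow_zero, mul_one, ← mul_assoc]
        have : c' ≤ |L 0| := (min_le_right _ _).trans (min_le_left _ _)
        nlinarith [abs_nonneg (L 0)]
      · obtain ⟨m, hm⟩ : ∃ m, n = m + 1 := ⟨n - 1, by omega⟩
        have hmin : 1 / 2 ≤ q * (B * |L m|) :=
          not_lt.1 (Nat.find_min hex (m := m) (by omega))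
        have hr := hratio m
        rw [hm]
        have hcc : c' ≤ c / 2 := min_le_left _ _
        calc c' * ρ ^ (m + 1) ≤ c / 2 * ρ ^ m := by
              gcongr ?_ * ?_
              exact pow_le_pow_of_le_one hρ.le hρ1 (Nat.le_succ m)
          _ = c * ρ ^ m * (1 / 2) := by ring
          _ ≤ c * ρ ^ m * (q * (B * |L m|)) := by
              have := hρn m
              gcongr
          _ = q * (B * (c * ρ ^ m * |L m|)) := by ring
          _ ≤ _ := by gcongr
    have herr : H n * Y / M < c' * ρ ^ n := by
      rw [div_lt_iff₀ hM0']
      have h1 : 2 * Y * (H n₀ / ρ ^ n₀) = c' * T := by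
        rw [hT]; simp only [C₁]; field_simp
      have h2 : H n ≤ H n₀ / ρ ^ n₀ * ρ ^ n := by
        rw [div_mul_eq_mul_div, le_div_iff₀ (hρn _)]
        have h3 : ρ ^ n₀ ≤ ρ ^ n := pow_le_pow_of_le_one hρ.le hρ1 hnn₀
        have hHn := hH hnn₀
        have hHn₀ : 0 ≤ H n₀ := zero_le_one.trans (hH1 n₀)
        gcongr
      have hHn := hH1 n
      calc H n * Y < 2 * Y * H n := by nlinarith
        _ ≤ 2 * Y * (H n₀ / ρ ^ n₀ * ρ ^ n) := by gcongr
        _ = c' * T * ρ ^ n := by rw [← h1]; ring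
        _ ≤ c' * M * ρ ^ n := by
            have := hρn n
            gcongr
        _ = _ := by ring
    have habs : |(q : ℝ) * (B * L n)| = q * (B * |L n|) := by
      rw [abs_mul, abs_mul, Nat.abs_cast, Nat.abs_cast]
    have hX1 : |(X : ℝ)| < 1 := by
      have h5 : H n * Y / M < 1 / 2 := by linarith
      have := abs_sub_abs_le_abs_sub (X : ℝ) (q * (B * L n))
      linarith
    have hX0 : X = 0 := by
      have : |X| < 1 := by exact_mod_cast hX1
      exact Int.abs_lt_one_iff.1 this
    rw [hX0, Int.cast_zero, zero_sub, abs_neg, habs] at hX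
    linarith
  have hfin : (q : ℝ) ≤ (2 * C₁) ^ D * (H n₀ / ρ ^ n₀) ^ D := by
    refine hqM'.trans ?_
    rw [← mul_pow]
    refine pow_le_pow_left₀ hM0'.le ?_ _
    rw [mul_assoc]
    exact hM2
  calc (1 : ℝ) ≤ 2 * (q * (B * |L n₀|)) := by linarith
    _ ≤ 2 * ((2 * C₁) ^ D * (H n₀ / ρ ^ n₀) ^ D * (B * |L n₀|)) := by gcongr
    _ = _ := by ring

/-- `f` is a sum of simple fractions with poles at `0, -1, …, -n` of order at most `a + 1`, whose
coefficients have denominators controlled by powers of `d` and `ℓ¹`-norm at most `B`. -/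
def HasPartialFractions (n d a : ℕ) (B : ℝ) (f : ℝ → ℝ) : Prop :=
  ∃ c : ℕ → ℕ → ℝ,
    (∀ t : ℝ, 0 < t →
      f t = ∑ s ∈ Finset.range (n + 1), ∑ j ∈ Finset.range (a + 1), c s j / (t + s) ^ (j + 1)) ∧
    (∀ s j, j ≤ a → ∃ m : ℤ, (d : ℝ) ^ (a - j) * c s j = m) ∧
    ∑ s ∈ Finset.range (n + 1), ∑ j ∈ Finset.range (a + 1), |c s j| ≤ B

namespace HasPartialFractions

variable {n d a : ℕ} {B B' : ℝ} {f g : ℝ → ℝ}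

lemma congr (hf : HasPartialFractions n d a B f) (h : ∀ t, 0 < t → g t = f t) :
    HasPartialFractions n d a B g := by
  obtain ⟨c, h1, h2, h3⟩ := hf
  exact ⟨c, fun t ht => (h t ht).trans (h1 t ht), h2, h3⟩

lemma mono (hf : HasPartialFractions n d a B f) (h : B ≤ B') :
    HasPartialFractions n d a B' f := by
  obtain ⟨c, h1, h2, h3⟩ := hf
  exact ⟨c, h1, h2, h3.trans h⟩

lemma zero : HasPartialFractions n d a 0 (fun _ => 0) :=
  ⟨fun _ _ => 0, fun t _ => by simp, fun _ _ _ => ⟨0, by simp⟩, by simp⟩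

lemma add (hf : HasPartialFractions n d a B f) (hg : HasPartialFractions n d a B' g) :
    HasPartialFractions n d a (B + B') (fun t => f t + g t) := by
  obtain ⟨c, h1, h2, h3⟩ := hf
  obtain ⟨c', h1', h2', h3'⟩ := hg
  refine ⟨fun s j => c s j + c' s j, fun t ht => ?_, fun s j hj => ?_, ?_⟩
  · simp only [h1 t ht, h1' t ht, ← Finset.sum_add_distrib, add_div]
  · obtain ⟨m, hm⟩ := h2 s j hj
    obtain ⟨m', hm'⟩ := h2' s j hj
    exact ⟨m + m', by push_cast; rw [← hm, ← hm']; ring⟩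
  · refine le_trans ?_ (add_le_add h3 h3')
    simp only [← Finset.sum_add_distrib]
    exact Finset.sum_le_sum fun s _ => Finset.sum_le_sum fun j _ => abs_add_le _ _

lemma sum {ι : Type*} (S : Finset ι) {B : ι → ℝ} {f : ι → ℝ → ℝ}
    (h : ∀ i ∈ S, HasPartialFractions n d a (B i) (f i)) :
    HasPartialFractions n d a (∑ i ∈ S, B i) (fun t => ∑ i ∈ S, f i t) := by
  classical
  induction S using Finset.induction_on with
  | empty => simpa using zero
  | insert i S hi ih =>
    simp only [Finset.sum_insert hi]
    exact (h i (by simp)).add (ih fun k hk => h k (by simp [hk]))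

lemma const_mul (hf : HasPartialFractions n d a B f) (e : ℤ) :
    HasPartialFractions n d a (|(e : ℝ)| * B) (fun t => e * f t) := by
  obtain ⟨c, h1, h2, h3⟩ := hf
  refine ⟨fun s j => e * c s j, fun t ht => ?_, fun s j hj => ?_, ?_⟩
  · simp only [h1 t ht, Finset.mul_sum, mul_div_assoc]
  · obtain ⟨m, hm⟩ := h2 s j hj
    exact ⟨e * m, by push_cast; rw [← hm]; ring⟩
  · simp only [abs_mul, ← Finset.mul_sum]
    exact mul_le_mul_of_nonneg_left h3 (abs_nonneg _)

lemma monomial {s j : ℕ} (hs : s ≤ n) (hj : j ≤ a) (x : ℝ)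
    (hx : ∃ m : ℤ, (d : ℝ) ^ (a - j) * x = m) :
    HasPartialFractions n d a |x| (fun t => x / (t + s) ^ (j + 1)) := by
  classical
  refine ⟨fun s' j' => if s' = s ∧ j' = j then x else 0, fun t _ => ?_, fun s' j' hj' => ?_, ?_⟩
  · rw [Finset.sum_eq_single_of_mem s (by simpa using hs.trans_lt (Nat.lt_succ_self n)),
      Finset.sum_eq_single_of_mem j (by simpa using hj.trans_lt (Nat.lt_succ_self a))]
    · simp
    · intro b _ hb
      simp [hb]
    · intro b _ hb
      simp [hb]
  · dsimp only
    split_ifs with h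
    · rw [h.2]; exact hx
    · exact ⟨0, by simp⟩
  · rw [Finset.sum_eq_single_of_mem s (by simpa using hs.trans_lt (Nat.lt_succ_self n)),
      Finset.sum_eq_single_of_mem j (by simpa using hj.trans_lt (Nat.lt_succ_self a))]
    · simp
    · intro b _ hb
      simp [hb]
    · intro b _ hb
      simp [hb]

lemma monomial_mul_of_ne (hd : ∀ m : ℕ, 1 ≤ m → m ≤ n → m ∣ d) {i s : ℕ} (hi : i ≤ n)
    (hs : s ≤ n) (his : i ≠ s) (j : ℕ) (hj : j ≤ a) (x : ℝ)
    (hx : ∃ m : ℤ, (d : ℝ) ^ (a - j) * x = m) :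
    HasPartialFractions n d (a + 1) ((j + 2) * |x|)
      (fun t => x / (t + s) ^ (j + 1) * (1 / (t + i))) := by
  have hδ0 : ((i : ℝ) - s) ≠ 0 := sub_ne_zero.2 (by exact_mod_cast his)
  have hδ1 : 1 ≤ |(i : ℝ) - s| := by
    have : (1 : ℤ) ≤ |(i : ℤ) - s| := Int.one_le_abs (by omega)
    exact_mod_cast this
  obtain ⟨k, hk⟩ : ∃ k : ℤ, (d : ℝ) / ((i : ℝ) - s) = k := by
    have h1 : ((i : ℤ) - s) ∣ (d : ℤ) := by
      have h2 : ((i : ℤ) - s).natAbs ∣ d := hd _ (by omega) (by omega)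
      exact Int.natAbs_dvd.1 (Int.natCast_dvd_natCast.2 h2)
    obtain ⟨k, hk⟩ := h1
    refine ⟨k, ?_⟩
    rw [div_eq_iff hδ0]
    have : (d : ℝ) = ((i : ℝ) - s) * k := by exact_mod_cast hk
    rw [this]; ring
  have habs (x : ℝ) : |x / ((i : ℝ) - s)| ≤ |x| := by
    rw [abs_div]
    exact div_le_self (abs_nonneg _) hδ1
  have hmul (x : ℝ) (l : ℕ) (hx : ∃ m : ℤ, (d : ℝ) ^ l * x = m) :
      ∃ m : ℤ, (d : ℝ) ^ (l + 1) * (x / ((i : ℝ) - s)) = m := by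
    obtain ⟨m, hm⟩ := hx
    refine ⟨m * k, ?_⟩
    push_cast
    rw [← hm, ← hk]; field_simp; ring
  induction j generalizing x with
  | zero =>
    have h1 := monomial (d := d) (a := a + 1) hs (Nat.zero_le _) (x / ((i : ℝ) - s))
      (by simpa using hmul x a (by simpa using hx))
    have h2 := (monomial (d := d) (a := a + 1) hi (Nat.zero_le _) (x / ((i : ℝ) - s))
      (by simpa using hmul x a (by simpa using hx))).const_mul (-1)
    refine ((h1.add h2).mono (B' := ((0 : ℕ) + 2) * |x|) ?_).congr fun t ht => ?_
    · have := habs x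
      simp only [Int.cast_neg, Int.cast_one, abs_neg, abs_one, Nat.cast_zero]
      linarith
    · have h3 : t + s ≠ 0 := by positivity
      have h4 : t + i ≠ 0 := by positivity
      push_cast
      field_simp
      ring
  | succ j ih =>
    have hx' := hmul x _ hx
    have e1 : a - (j + 1) + 1 = a - j := by omega
    have h1 := monomial (d := d) (a := a + 1) (j := j + 1) hs (by omega) (x / ((i : ℝ) - s))
      (by
        have e2 : a + 1 - (j + 1) = a - (j + 1) + 1 := by omega
        rw [e2]; exact hx')
    have h2 := (ih (by omega) (x / ((i : ℝ) - s)) (by rw [← e1]; exact hx')).const_mul (-1)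
    refine ((h1.add h2).mono (B' := ((j + 1 : ℕ) + 2) * |x|) ?_).congr fun t ht => ?_
    · have := habs x
      simp only [Int.cast_neg, Int.cast_one, abs_neg, abs_one]
      push_cast
      nlinarith
    · have h3 : t + s ≠ 0 := by positivity
      have h4 : t + i ≠ 0 := by positivity
      push_cast
      field_simp
      ring

lemma monomial_mul (hd : ∀ m : ℕ, 1 ≤ m → m ≤ n → m ∣ d) {i s : ℕ} (hi : i ≤ n)
    (hs : s ≤ n) (j : ℕ) (hj : j ≤ a) (x : ℝ) (hx : ∃ m : ℤ, (d : ℝ) ^ (a - j) * x = m) :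
    HasPartialFractions n d (a + 1) ((a + 2) * |x|)
      (fun t => x / (t + s) ^ (j + 1) * (1 / (t + i))) := by
  have hj' : (j : ℝ) ≤ a := by exact_mod_cast hj
  rcases eq_or_ne i s with rfl | his
  · refine ((monomial (d := d) (a := a + 1) (j := j + 1) hs (by omega) x (by
      simpa using hx)).mono ?_).congr fun t ht => ?_
    · nlinarith [abs_nonneg x]
    · have h3 : t + i ≠ 0 := by positivity
      field_simp
      ring
  · refine (monomial_mul_of_ne hd hi hs his j hj x hx).mono ?_
    gcongr

lemma mul_simple (hd : ∀ m : ℕ, 1 ≤ m → m ≤ n → m ∣ d) (hf : HasPartialFractions n d a B f)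
    (e : ℕ → ℤ) :
    HasPartialFractions n d (a + 1)
      ((a + 2) * B * ∑ i ∈ Finset.range (n + 1), |(e i : ℝ)|)
      (fun t => f t * ∑ i ∈ Finset.range (n + 1), e i / (t + i)) := by
  obtain ⟨c, h1, h2, h3⟩ := hf
  have key : HasPartialFractions n d (a + 1)
      (∑ i ∈ Finset.range (n + 1), |(e i : ℝ)| * ∑ s ∈ Finset.range (n + 1),
        ∑ j ∈ Finset.range (a + 1), (a + 2) * |c s j|)
      (fun t => ∑ i ∈ Finset.range (n + 1), (e i : ℝ) * ∑ s ∈ Finset.range (n + 1),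
        ∑ j ∈ Finset.range (a + 1), c s j / (t + s) ^ (j + 1) * (1 / (t + i))) := by
    refine sum _ fun i hi => const_mul (sum _ fun s hs => sum _ fun j hj => ?_) (e i)
    rw [Finset.mem_range] at hi hs hj
    exact monomial_mul hd (by omega) (by omega) j (by omega) _ (h2 s j (by omega))
  refine (key.mono ?_).congr fun t ht => ?_
  · simp only [← Finset.mul_sum, ← Finset.sum_mul]
    rw [mul_comm]
    gcongr
  · rw [h1 t ht, Finset.mul_sum]
    refine Finset.sum_congr rfl fun i _ => ?_
    simp only [Finset.sum_mul, Finset.mul_sum]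
    exact Finset.sum_congr rfl fun s _ => Finset.sum_congr rfl fun j _ => by ring

/-- A product of simple partial fractions with integral coefficients. -/
theorem prod (hd : ∀ m : ℕ, 1 ≤ m → m ≤ n → m ∣ d) (e : ℕ → ℕ → ℤ) (a : ℕ) :
    HasPartialFractions n d a
      ((a + 1).factorial * ∏ k ∈ Finset.range (a + 1), ∑ i ∈ Finset.range (n + 1), |(e k i : ℝ)|)
      (fun t => ∏ k ∈ Finset.range (a + 1), ∑ i ∈ Finset.range (n + 1), (e k i : ℝ) / (t + i)) := by
  induction a with
  | zero =>
    refine ⟨fun s _ => e 0 s, fun t _ => by simp, fun s j _ => ⟨d ^ (0 - j) * e 0 s, by simp⟩,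
      by simp⟩
  | succ a ih =>
    refine ((mul_simple hd ih (e (a + 1))).mono (le_of_eq ?_)).congr fun t _ => ?_
    · rw [Finset.prod_range_succ _ (a + 1), Nat.factorial_succ (a + 1)]
      push_cast
      ring
    · rw [Finset.prod_range_succ _ (a + 1)]

end HasPartialFractions

lemma summable_Li_term {w : ℝ} (hw : |w| < 1) (j : ℕ) :
    Summable fun n : ℕ => w ^ (n + 1) / (n + 1 : ℝ) ^ j := by
  have h : Summable fun n : ℕ => |w| ^ (n + 1) :=
    (summable_nat_add_iff 1).2 (summable_geometric_of_lt_one (abs_nonneg w) hw)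
  refine h.of_norm_bounded fun n => ?_
  rw [norm_div, norm_pow, Real.norm_eq_abs, norm_pow, Real.norm_eq_abs,
    abs_of_nonneg (by positivity : (0 : ℝ) ≤ n + 1)]
  exact div_le_self (by positivity) (one_le_pow₀ (by simp))

lemma hasSum_shifted_Li {w : ℝ} (hw : |w| < 1) (hw0 : w ≠ 0) (s j : ℕ) :
    HasSum (fun k : ℕ => w ^ (k + 1) / ((k + 1 : ℝ) + s) ^ j)
      (w⁻¹ ^ s * (Li j w - ∑ m ∈ Finset.range s, w ^ (m + 1) / (m + 1 : ℝ) ^ j)) := by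
  have h := (hasSum_nat_add_iff' s).2 (summable_Li_term hw j).hasSum
  have h2 := h.mul_left (w⁻¹ ^ s)
  have e (k : ℕ) : w⁻¹ ^ s * (w ^ (k + s + 1) / (((k + s : ℕ) : ℝ) + 1) ^ j) =
      w ^ (k + 1) / ((k + 1 : ℝ) + s) ^ j := by
    rw [← mul_div_assoc, show k + s + 1 = s + (k + 1) by ring, pow_add, ← mul_assoc, ← mul_pow,
      inv_mul_cancel₀ hw0, one_pow, one_mul]
    push_cast
    ring_nf
  simp only [e] at h2
  exact h2

lemma rat_pow_mul_den_pow (z : ℚ) {u n : ℕ} (hu : u ≤ n) :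
    (z : ℝ) ^ u * (z.den : ℝ) ^ n = (z.num : ℝ) ^ u * (z.den : ℝ) ^ (n - u) := by
  have h : (z : ℝ) * z.den = z.num := by exact_mod_cast Rat.mul_den_eq_num z
  rw [← h, mul_pow, mul_assoc, ← pow_add]
  congr 3; omega

lemma rat_pow_mul_den_pow_mem (z : ℚ) {u n : ℕ} (hu : u ≤ n) :
    (z : ℝ) ^ u * (z.den : ℝ) ^ n ∈ (Int.castRingHom ℝ).range := by
  rw [rat_pow_mul_den_pow z hu]
  exact ⟨z.num ^ u * z.den ^ (n - u), by simp⟩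

lemma den_lt_abs_num {z : ℚ} (hz : 1 < |z|) : (z.den : ℝ) < |(z.num : ℝ)| := by
  have h : (z : ℝ) * z.den = z.num := by exact_mod_cast Rat.mul_den_eq_num z
  have hd : (0 : ℝ) < z.den := by exact_mod_cast z.den_pos
  have hz' : (1 : ℝ) < |(z : ℝ)| := by exact_mod_cast hz
  rw [← h, abs_mul, abs_of_pos hd]
  nlinarith

lemma abs_rat_pow_mul_den_pow_le {z : ℚ} (hz : 1 < |z|) {u n : ℕ} (hu : u ≤ n) :
    |(z : ℝ) ^ u * (z.den : ℝ) ^ n| ≤ |(z.num : ℝ)| ^ n := by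
  rw [rat_pow_mul_den_pow z hu, abs_mul, abs_pow, abs_pow, Nat.abs_cast]
  have h := (den_lt_abs_num hz).le
  calc _ ≤ |(z.num : ℝ)| ^ u * |(z.num : ℝ)| ^ (n - u) := by gcongr
    _ = _ := by rw [← pow_add]; congr 1; omega

/-- The values at `1 / z` of a series whose general term has a partial fraction expansion are
rational linear forms in polylogarithms, with control on denominators and coefficients. -/
theorem HasPartialFractions.exists_linearForm {n d a : ℕ} {B : ℝ} {f : ℝ → ℝ}
    (hd : ∀ m : ℕ, 1 ≤ m → m ≤ n → m ∣ d)
    (hf : HasPartialFractions n d a B f) {z : ℚ} (hz : 1 < |z|) :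
    ∃ A : ℕ → ℤ,
      (d : ℝ) ^ (a + 1) * (z.den : ℝ) ^ n * ∑' k : ℕ, f (k + 1) * (1 / (z : ℝ)) ^ (k + 1) =
        ∑ j ∈ Finset.range (a + 2), A j * (if j = 0 then 1 else Li j (1 / (z : ℝ))) ∧
      ∀ j ∈ Finset.range (a + 2),
        |(A j : ℝ)| ≤ (d : ℝ) ^ (a + 1) * |(z.num : ℝ)| ^ n * ((n + 1) * B) := by
  obtain ⟨c, h1, h2, h3⟩ := hf
  have hz' : (1 : ℝ) < |(z : ℝ)| := by exact_mod_cast hz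
  have hz0 : (z : ℝ) ≠ 0 := by
    intro h; rw [h, abs_zero] at hz'; linarith
  set w : ℝ := 1 / (z : ℝ) with hw
  have hwinv : w⁻¹ = z := by simp [hw]
  have hw0 : w ≠ 0 := by simpa [hw] using hz0
  have hw1 : |w| < 1 := by
    rw [hw, abs_div, abs_one]
    exact (div_lt_one (by linarith)).2 hz'
  let R := (Int.castRingHom ℝ).range
  have hsum : ∑' k : ℕ, f (k + 1) * w ^ (k + 1) =
      ∑ s ∈ Finset.range (n + 1), ∑ j ∈ Finset.range (a + 1), c s j *
        ((z : ℝ) ^ s * (Li (j + 1) w - ∑ m ∈ Finset.range s, w ^ (m + 1) / (m + 1 : ℝ) ^ (j + 1))) := by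
    have h := hasSum_sum (s := Finset.range (n + 1)) fun s _ =>
      hasSum_sum (s := Finset.range (a + 1)) fun j _ =>
        (hasSum_shifted_Li hw1 hw0 s (j + 1)).mul_left (c s j)
    rw [hwinv] at h
    rw [← h.tsum_eq]
    refine tsum_congr fun k => ?_
    rw [h1 _ (by positivity), Finset.sum_mul]
    refine Finset.sum_congr rfl fun s _ => ?_
    rw [Finset.sum_mul]
    exact Finset.sum_congr rfl fun j _ => by ring
  have hdc (s j : ℕ) (hj : j ≤ a) : (d : ℝ) ^ (a - j) * c s j ∈ R := by
    obtain ⟨m, hm⟩ := h2 s j hj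
    exact ⟨m, by simp [hm]⟩
  have hdR : (d : ℝ) ∈ R := ⟨d, by simp⟩
  have hpos : 0 ≤ (d : ℝ) ^ (a + 1) * |(z.num : ℝ)| ^ n := by positivity
  have hBsum (j : ℕ) (hj : j ∈ Finset.range (a + 1)) :
      ∑ s ∈ Finset.range (n + 1), |c s j| ≤ B :=
    le_trans (Finset.sum_le_sum fun s _ =>
      Finset.single_le_sum (f := fun j => |c s j|) (fun _ _ => abs_nonneg _) hj) h3
  have hB0 : 0 ≤ B := le_trans (by positivity) h3
  have hA (j : ℕ) (hj : j ≤ a) : ∃ m : ℤ, (m : ℝ) =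
      (d : ℝ) ^ (a + 1) * (z.den : ℝ) ^ n * ∑ s ∈ Finset.range (n + 1), c s j * (z : ℝ) ^ s := by
    have : (d : ℝ) ^ (a + 1) * (z.den : ℝ) ^ n *
        ∑ s ∈ Finset.range (n + 1), c s j * (z : ℝ) ^ s ∈ R := by
      rw [Finset.mul_sum]
      refine sum_mem fun s hs => ?_
      have e : (d : ℝ) ^ (a + 1) * (z.den : ℝ) ^ n * (c s j * (z : ℝ) ^ s) =
          (d : ℝ) ^ (j + 1) * ((d : ℝ) ^ (a - j) * c s j) * ((z : ℝ) ^ s * (z.den : ℝ) ^ n) := by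
        have : a + 1 = (j + 1) + (a - j) := by omega
        rw [this, pow_add]; ring
      rw [e]
      exact mul_mem (mul_mem (pow_mem hdR _) (hdc s j hj))
        (rat_pow_mul_den_pow_mem z (by rw [Finset.mem_range] at hs; omega))
    obtain ⟨m, hm⟩ := this
    exact ⟨m, hm⟩
  have hzw {s m : ℕ} (hm : m < s) : (z : ℝ) ^ s * w ^ (m + 1) = (z : ℝ) ^ (s - (m + 1)) := by
    have : (z : ℝ) ^ s = (z : ℝ) ^ (s - (m + 1)) * (z : ℝ) ^ (m + 1) := by
      rw [← pow_add]; congr 1; omega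
    rw [this, mul_assoc, ← mul_pow, hw, mul_one_div_cancel hz0, one_pow, mul_one]
  let T : ℕ → ℕ → ℝ := fun s j =>
    ∑ m ∈ Finset.range s, ((z : ℝ) ^ (s - (m + 1)) * (z.den : ℝ) ^ n) / (m + 1 : ℝ) ^ (j + 1)
  have hT (s j : ℕ) : (z.den : ℝ) ^ n *
      ((z : ℝ) ^ s * ∑ m ∈ Finset.range s, w ^ (m + 1) / (m + 1 : ℝ) ^ (j + 1)) = T s j := by
    simp only [T]
    rw [Finset.mul_sum, Finset.mul_sum]
    refine Finset.sum_congr rfl fun m hm => ?_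
    rw [← hzw (Finset.mem_range.1 hm)]
    ring
  have hA0 : ∃ m : ℤ, (m : ℝ) =
      -∑ s ∈ Finset.range (n + 1), ∑ j ∈ Finset.range (a + 1),
        (d : ℝ) ^ (a + 1) * (c s j * T s j) := by
    have : -∑ s ∈ Finset.range (n + 1), ∑ j ∈ Finset.range (a + 1),
        (d : ℝ) ^ (a + 1) * (c s j * T s j) ∈ R := by
      refine neg_mem (sum_mem fun s hs => sum_mem fun j hj => ?_)
      rw [Finset.mem_range] at hs hj
      have e : (d : ℝ) ^ (a + 1) * (c s j * T s j) =
          ((d : ℝ) ^ (a - j) * c s j) * ((d : ℝ) ^ (j + 1) * T s j) := by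
        have : a + 1 = (j + 1) + (a - j) := by omega
        rw [this, pow_add]; ring
      rw [e]
      refine mul_mem (hdc s j (by omega)) ?_
      simp only [T]
      rw [Finset.mul_sum]
      refine sum_mem fun m hm => ?_
      rw [Finset.mem_range] at hm
      obtain ⟨k, hk⟩ := hd (m + 1) (by omega) (by omega)
      have e2 : (d : ℝ) ^ (j + 1) *
          ((z : ℝ) ^ (s - (m + 1)) * (z.den : ℝ) ^ n / (m + 1 : ℝ) ^ (j + 1)) =
          (k : ℝ) ^ (j + 1) * ((z : ℝ) ^ (s - (m + 1)) * (z.den : ℝ) ^ n) := by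
        have : (d : ℝ) = (m + 1) * k := by rw [hk]; push_cast; ring
        rw [this, mul_pow]
        have : (m + 1 : ℝ) ^ (j + 1) ≠ 0 := by positivity
        field_simp
      rw [e2]
      exact mul_mem (pow_mem (⟨k, by simp⟩ : (k : ℝ) ∈ R) _) (rat_pow_mul_den_pow_mem z (by omega))
    obtain ⟨m, hm⟩ := this
    exact ⟨m, hm⟩
  have hTle (s j : ℕ) (hs : s ≤ n) : |T s j| ≤ (n + 1) * |(z.num : ℝ)| ^ n := by
    simp only [T]
    calc _ ≤ ∑ m ∈ Finset.range s, |(z.num : ℝ)| ^ n := by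
          refine (Finset.abs_sum_le_sum_abs _ _).trans (Finset.sum_le_sum fun m _ => ?_)
          rw [abs_div]
          refine (div_le_self (abs_nonneg _) ?_).trans (abs_rat_pow_mul_den_pow_le hz (by omega))
          rw [abs_of_nonneg (by positivity)]
          exact one_le_pow₀ (by simp)
      _ = s * |(z.num : ℝ)| ^ n := by simp
      _ ≤ _ := by
          have : (s : ℝ) ≤ n := by exact_mod_cast hs
          gcongr
          linarith
  choose m hm using hA
  obtain ⟨m₀, hm₀⟩ := hA0
  refine ⟨fun j => match j with
    | 0 => m₀
    | j + 1 => if hj : j ≤ a then m j hj else 0, ?_, ?_⟩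
  · rw [Finset.sum_range_succ', hsum]
    simp only [if_true, mul_one, Nat.add_one_ne_zero, if_false]
    have e1 : ∑ j ∈ Finset.range (a + 1),
        ((if hj : j ≤ a then m j hj else 0 : ℤ) : ℝ) * Li (j + 1) w =
        ∑ j ∈ Finset.range (a + 1), (d : ℝ) ^ (a + 1) * (z.den : ℝ) ^ n *
          (∑ s ∈ Finset.range (n + 1), c s j * (z : ℝ) ^ s) * Li (j + 1) w := by
      refine Finset.sum_congr rfl fun j hj => ?_
      rw [dif_pos (by rw [Finset.mem_range] at hj; omega), hm]
    rw [e1, hm₀]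
    simp only [← hT, Finset.mul_sum, Finset.sum_mul]
    rw [Finset.sum_comm (s := Finset.range (a + 1)), ← sub_eq_add_neg, ← Finset.sum_sub_distrib]
    refine Finset.sum_congr rfl fun s _ => ?_
    rw [← Finset.sum_sub_distrib]
    refine Finset.sum_congr rfl fun j _ => ?_
    rw [mul_sub, mul_sub, mul_sub, Finset.mul_sum, Finset.mul_sum, Finset.mul_sum]
    congr 1
    · ring
    · exact Finset.sum_congr rfl fun _ _ => by ring
  · intro j hj
    rcases j with _ | j
    · dsimp only
      rw [hm₀, abs_neg]
      calc _ ≤ ∑ s ∈ Finset.range (n + 1), ∑ j ∈ Finset.range (a + 1),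
            (d : ℝ) ^ (a + 1) * (|c s j| * ((n + 1) * |(z.num : ℝ)| ^ n)) := by
            refine (Finset.abs_sum_le_sum_abs _ _).trans (Finset.sum_le_sum fun s hs => ?_)
            refine (Finset.abs_sum_le_sum_abs _ _).trans (Finset.sum_le_sum fun j _ => ?_)
            rw [abs_mul, abs_pow, Nat.abs_cast, abs_mul]
            have := hTle s j (by rw [Finset.mem_range] at hs; omega)
            gcongr
        _ = (d : ℝ) ^ (a + 1) * |(z.num : ℝ)| ^ n * ((n + 1) *
            ∑ s ∈ Finset.range (n + 1), ∑ j ∈ Finset.range (a + 1), |c s j|) := by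
            simp only [Finset.mul_sum]
            exact Finset.sum_congr rfl fun _ _ => Finset.sum_congr rfl fun _ _ => by ring
        _ ≤ _ := by gcongr
    · rw [Finset.mem_range] at hj
      have hj' : j ≤ a := by omega
      simp only [dif_pos hj', hm]
      have e : (d : ℝ) ^ (a + 1) * (z.den : ℝ) ^ n *
          ∑ s ∈ Finset.range (n + 1), c s j * (z : ℝ) ^ s =
          (d : ℝ) ^ (a + 1) * ∑ s ∈ Finset.range (n + 1),
            c s j * ((z : ℝ) ^ s * (z.den : ℝ) ^ n) := by
        simp only [Finset.mul_sum]
        exact Finset.sum_congr rfl fun _ _ => by ring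
      rw [e, abs_mul, abs_pow, Nat.abs_cast, mul_assoc]
      refine mul_le_mul_of_nonneg_left ?_ (by positivity)
      calc _ ≤ ∑ s ∈ Finset.range (n + 1), |c s j| * |(z.num : ℝ)| ^ n := by
            refine (Finset.abs_sum_le_sum_abs _ _).trans (Finset.sum_le_sum fun s hs => ?_)
            rw [abs_mul]
            refine mul_le_mul_of_nonneg_left (abs_rat_pow_mul_den_pow_le hz ?_) (abs_nonneg _)
            rw [Finset.mem_range] at hs; omega
        _ = (∑ s ∈ Finset.range (n + 1), |c s j|) * |(z.num : ℝ)| ^ n := by rw [Finset.sum_mul]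
        _ ≤ B * |(z.num : ℝ)| ^ n := by
            gcongr
            exact hBsum j (Finset.mem_range.2 (by omega))
        _ ≤ |(z.num : ℝ)| ^ n * ((n + 1) * B) := by
            rw [mul_comm B]
            gcongr
            nlinarith [(Nat.cast_nonneg n : (0 : ℝ) ≤ n)]

/-- The Euler beta value `B(b + 1, n + 1)`. -/
noncomputable def natBeta (b n : ℕ) : ℝ :=
  (b.factorial * n.factorial : ℝ) / ((b + n + 1).factorial : ℝ)

lemma natBeta_pos (b n : ℕ) : 0 < natBeta b n := by
  unfold natBeta; positivity

lemma natBeta_succ_right (b n : ℕ) :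
    natBeta b (n + 1) = natBeta b n - natBeta (b + 1) n := by
  unfold natBeta
  rw [show b + (n + 1) + 1 = b + n + 1 + 1 by ring, show b + 1 + n + 1 = b + n + 1 + 1 by ring,
    Nat.factorial_succ (b + n + 1), Nat.factorial_succ n, Nat.factorial_succ b]
  push_cast
  field_simp
  ring

lemma integral_pow_mul_one_sub_pow (b n : ℕ) :
    ∫ x in (0 : ℝ)..1, x ^ b * (1 - x) ^ n = natBeta b n := by
  induction n generalizing b with
  | zero =>
    simp only [pow_zero, mul_one, integral_pow, natBeta]
    rw [Nat.add_zero, Nat.factorial_succ]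
    push_cast
    field_simp
    simp
  | succ n ih =>
    rw [natBeta_succ_right, ← ih, ← ih, ← intervalIntegral.integral_sub]
    · refine intervalIntegral.integral_congr fun x _ => ?_
      ring
    · exact (by fun_prop : Continuous fun x : ℝ => x ^ b * (1 - x) ^ n).intervalIntegrable _ _
    · exact (by fun_prop : Continuous fun x : ℝ => x ^ (b + 1) * (1 - x) ^ n).intervalIntegrable _ _

lemma natBeta_le_one (b n : ℕ) : natBeta b n ≤ 1 := by
  unfold natBeta
  rw [div_le_one (by positivity)]
  have h := Nat.le_of_dvd (Nat.factorial_pos _) (Nat.factorial_mul_factorial_dvd_factorial_add b n)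
  have h2 := Nat.factorial_le (Nat.le_succ (b + n))
  exact_mod_cast h.trans h2

lemma tsum_mul_natBeta_nonneg (b n : ℕ) {c : ℕ → ℝ} (hc : Summable fun m => |c m|)
    (h : ∀ y ∈ Set.Icc (0 : ℝ) 1, 0 ≤ ∑' m, c m * y ^ m) :
    ∀ y ∈ Set.Icc (0 : ℝ) 1, 0 ≤ ∑' m, c m * natBeta (b + m) n * y ^ m := by
  intro y hy
  let f : ℕ → C(ℝ, ℝ) := fun m => ⟨fun x => x ^ b * (1 - x) ^ n * (c m * (x * y) ^ m), by fun_prop⟩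
  have hsum : Summable fun m => ‖(f m).restrict (⟨Set.uIcc 0 1, isCompact_uIcc⟩ :
      TopologicalSpace.Compacts ℝ)‖ := by
    refine hc.of_nonneg_of_le (fun _ => norm_nonneg _) fun m => ?_
    rw [ContinuousMap.norm_le _ (abs_nonneg _)]
    rintro ⟨x, hx⟩
    have hx' : x ∈ Set.Icc (0 : ℝ) 1 := by simpa using hx
    obtain ⟨hx0, hx1⟩ := hx'
    have hxy : 0 ≤ x * y := mul_nonneg hx0 hy.1
    have hxy1 : x * y ≤ 1 := mul_le_one₀ hx1 hy.1 hy.2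
    simp only [f, ContinuousMap.restrict_apply, ContinuousMap.coe_mk, Real.norm_eq_abs, abs_mul,
      abs_pow]
    have e1 : |x| ^ b ≤ 1 := pow_le_one₀ (abs_nonneg _) (by rwa [abs_of_nonneg hx0])
    have e2 : |1 - x| ^ n ≤ 1 :=
      pow_le_one₀ (abs_nonneg _) (by rw [abs_of_nonneg (by linarith)]; linarith)
    have e3 : (|x| * |y|) ^ m ≤ 1 :=
      pow_le_one₀ (by positivity) (by rwa [abs_of_nonneg hx0, abs_of_nonneg hy.1])
    calc _ ≤ 1 * 1 * (|c m| * 1) := by gcongr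
      _ = _ := by ring
  have h_int := (intervalIntegral.hasSum_intervalIntegral_of_summable_norm hsum).tsum_eq
  have hterm (m : ℕ) : ∫ x in (0 : ℝ)..1, f m x = c m * natBeta (b + m) n * y ^ m := by
    rw [← integral_pow_mul_one_sub_pow, mul_right_comm, ← intervalIntegral.integral_const_mul]
    refine intervalIntegral.integral_congr fun x _ => ?_
    simp only [f, ContinuousMap.coe_mk]
    ring
  simp only [hterm] at h_int
  rw [h_int]
  refine intervalIntegral.integral_nonneg zero_le_one fun x hx => ?_
  simp only [f, ContinuousMap.coe_mk, tsum_mul_left]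
  have h1 : (0 : ℝ) ≤ 1 - x := by linarith [hx.2]
  exact mul_nonneg (mul_nonneg (pow_nonneg hx.1 _) (pow_nonneg h1 _))
    (h _ ⟨mul_nonneg hx.1 hy.1, mul_le_one₀ hx.2 hy.1 hy.2⟩)

lemma tsum_mul_natBeta_pow_nonneg (b n a : ℕ) {c : ℕ → ℝ} (hc : Summable fun m => |c m|)
    (h : ∀ y ∈ Set.Icc (0 : ℝ) 1, 0 ≤ ∑' m, c m * y ^ m) :
    ∀ y ∈ Set.Icc (0 : ℝ) 1, 0 ≤ ∑' m, c m * natBeta (b + m) n ^ a * y ^ m := by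
  induction a with
  | zero => simpa using h
  | succ a ih =>
    have hs : Summable fun m => |c m * natBeta (b + m) n ^ a| := by
      refine hc.of_nonneg_of_le (fun _ => abs_nonneg _) fun m => ?_
      rw [abs_mul, abs_of_nonneg (pow_nonneg (natBeta_pos _ _).le _)]
      exact mul_le_of_le_one_right (abs_nonneg _)
        (pow_le_one₀ (natBeta_pos _ _).le (natBeta_le_one _ _))
    have := tsum_mul_natBeta_nonneg b n hs ih
    simpa only [pow_succ, mul_assoc] using this

lemma natBeta_pow_mul_le_tsum (b n a : ℕ) {c : ℕ → ℝ} (hc : Summable fun m => |c m|) {l : ℝ}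
    (h : ∀ y ∈ Set.Icc (0 : ℝ) 1, l ≤ ∑' m, c m * y ^ m) :
    l * natBeta b n ^ a ≤ ∑' m, c m * natBeta (b + m) n ^ a := by
  classical
  let δ : ℕ → ℝ := fun m => if m = 0 then l else 0
  have hδ (g : ℕ → ℝ) : HasSum (fun m => δ m * g m) (l * g 0) := by
    have := hasSum_single (f := fun m => δ m * g m) 0 (fun m hm => by simp [δ, hm])
    simpa [δ] using this
  have hcs (g : ℕ → ℝ) (hg : ∀ m, |g m| ≤ 1) : Summable fun m => c m * g m := by
    refine hc.of_norm_bounded fun m => ?_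
    rw [Real.norm_eq_abs, abs_mul]
    exact mul_le_of_le_one_right (abs_nonneg _) (hg m)
  have hβ (m : ℕ) : |natBeta (b + m) n ^ a| ≤ 1 := by
    rw [abs_of_nonneg (pow_nonneg (natBeta_pos _ _).le _)]
    exact pow_le_one₀ (natBeta_pos _ _).le (natBeta_le_one _ _)
  have hs : Summable fun m => |c m - δ m| := by
    have h1 : Summable fun m => c m := by simpa using hcs (fun _ => 1) (by simp)
    have h2 : Summable fun m => δ m := by simpa using (hδ fun _ => 1).summable
    exact (h1.sub h2).abs
  have key := tsum_mul_natBeta_pow_nonneg b n a hs (fun y hy => by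
    have h1 : Summable fun m => c m * y ^ m := hcs _ fun m => by
      rw [abs_pow, abs_of_nonneg hy.1]
      exact pow_le_one₀ hy.1 hy.2
    have h2 := hδ fun m => y ^ m
    simp only [sub_mul]
    rw [h1.tsum_sub h2.summable, h2.tsum_eq]
    simpa using h y hy) 1 (by simp)
  have h2 := hδ fun m => natBeta (b + m) n ^ a
  simp only [one_pow, mul_one, sub_mul] at key
  rw [(hcs _ hβ).tsum_sub h2.summable, h2.tsum_eq, Nat.add_zero] at key
  linarith

lemma tsum_le_mul_natBeta_pow (b n a : ℕ) {c : ℕ → ℝ} (hc : Summable fun m => |c m|) {l : ℝ}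
    (h : ∀ y ∈ Set.Icc (0 : ℝ) 1, ∑' m, c m * y ^ m ≤ l) :
    ∑' m, c m * natBeta (b + m) n ^ a ≤ l * natBeta b n ^ a := by
  have := natBeta_pow_mul_le_tsum b n a (c := fun m => -c m) (l := -l) (by simpa using hc)
    (fun y hy => by simpa [tsum_neg] using h y hy)
  simp only [neg_mul, tsum_neg] at this
  linarith

lemma choose_tsum_bounds (b n a N : ℕ) {w : ℝ} (hw : |w| < 1) :
    (1 / 2) ^ (N + 1) * natBeta b n ^ a ≤
        ∑' m, ((m + N).choose N * w ^ m) * natBeta (b + m) n ^ a ∧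
      ∑' m, ((m + N).choose N * w ^ m) * natBeta (b + m) n ^ a ≤
        (1 / (1 - |w|)) ^ (N + 1) * natBeta b n ^ a := by
  have hs : Summable fun m : ℕ => |((m + N).choose N * w ^ m : ℝ)| := by
    have := (hasSum_choose_mul_geometric_of_norm_lt_one N (r := |w|) (by simpa using hw)).summable
    refine this.congr fun m => ?_
    rw [abs_mul, abs_pow, Nat.abs_cast]
  have hval (y : ℝ) (hy : y ∈ Set.Icc (0 : ℝ) 1) :
      |w * y| < 1 ∧ |w * y| ≤ |w| ∧
        ∑' m, ((m + N).choose N * w ^ m) * y ^ m = (1 / (1 - w * y)) ^ (N + 1) := by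
    have h1 : |w * y| ≤ |w| := by
      rw [abs_mul, abs_of_nonneg hy.1]
      exact mul_le_of_le_one_right (abs_nonneg _) hy.2
    refine ⟨h1.trans_lt hw, h1, ?_⟩
    have := (hasSum_choose_mul_geometric_of_norm_lt_one N (r := w * y)
      (by simpa using h1.trans_lt hw)).tsum_eq
    rw [one_div_pow, ← this]
    refine tsum_congr fun m => ?_
    rw [mul_pow, mul_assoc]
  constructor
  · refine natBeta_pow_mul_le_tsum b n a hs fun y hy => ?_
    obtain ⟨h1, h2, h3⟩ := hval y hy
    rw [h3]
    have := abs_lt.1 h1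
    refine pow_le_pow_left₀ (by norm_num) ?_ _
    exact one_div_le_one_div_of_le (by linarith) (by linarith)
  · refine tsum_le_mul_natBeta_pow b n a hs fun y hy => ?_
    obtain ⟨h1, h2, h3⟩ := hval y hy
    rw [h3]
    have h4 := abs_lt.1 h1
    have h5 := le_abs_self (w * y)
    refine pow_le_pow_left₀ (one_div_nonneg.2 (by linarith)) ?_ _
    exact one_div_le_one_div_of_le (by linarith) (by linarith)

lemma prod_range_erase_sub {i n : ℕ} (h : i ≤ n) :
    ∏ j ∈ (Finset.range (n + 1)).erase i, ((j : ℝ) - i) =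
      (-1) ^ i * i.factorial * (n - i).factorial := by
  induction n, h using Nat.le_induction with
  | base =>
    rw [Finset.range_add_one, Finset.erase_insert (by simp), Nat.sub_self, Nat.factorial_zero,
      ← Nat.descFactorial_self, Nat.descFactorial_eq_prod_range]
    push_cast
    rw [mul_one, ← Finset.card_range i, ← Finset.prod_const, Finset.card_range,
      ← Finset.prod_mul_distrib]
    refine Finset.prod_congr rfl fun j hj => ?_
    rw [Nat.cast_sub (Finset.mem_range.1 hj).le]
    ring
  | succ n hn ih =>
    rw [Finset.range_add_one, Finset.erase_insert_of_ne (by omega),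
      Finset.prod_insert (by simp), ih, Nat.succ_sub hn, Nat.factorial_succ]
    push_cast [Nat.cast_sub hn]
    ring

/-- Partial fraction expansion of a proper rational function with denominator
`t (t + 1) ⋯ (t + n)`. -/
lemma eval_div_prod_range (n : ℕ) (P : Polynomial ℝ) (hP : P.degree < (n + 1 : ℕ)) {t : ℝ}
    (ht : 0 < t) :
    P.eval t / ∏ s ∈ Finset.range (n + 1), (t + s) =
      ∑ s ∈ Finset.range (n + 1),
        ((-1) ^ s * P.eval (-(s : ℝ)) / (s.factorial * (n - s).factorial)) / (t + s) := by
  let v : ℕ → ℝ := fun s => -(s : ℝ)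
  have hv : Set.InjOn v (Finset.range (n + 1)) := fun i _ j _ h => by simpa [v] using h
  have hpos : ∏ s ∈ Finset.range (n + 1), (t + s) ≠ 0 :=
    Finset.prod_ne_zero_iff.2 fun s _ => by positivity
  have h1 := Lagrange.eq_interpolate hv (f := P) (by simpa using hP)
  have h2 := Lagrange.eval_interpolate_not_at_node (s := Finset.range (n + 1)) (v := v) (x := t)
    (fun i => P.eval (v i)) (fun i _ => by
      simp only [v, ne_eq]
      intro h
      have : (0 : ℝ) ≤ i := Nat.cast_nonneg i
      linarith)
  rw [← h1, Lagrange.eval_nodal] at h2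
  simp only [v, sub_neg_eq_add] at h2
  rw [h2, mul_div_cancel_left₀ _ hpos]
  refine Finset.sum_congr rfl fun s hs => ?_
  have e := prod_range_erase_sub (Nat.lt_succ_iff.1 (Finset.mem_range.1 hs))
  rw [Lagrange.nodalWeight]
  simp only [Finset.prod_inv_distrib, neg_sub_neg]
  rw [e]
  have h3 : ((-1 : ℝ) ^ s)⁻¹ = (-1) ^ s := by rw [← inv_pow]; norm_num
  rw [mul_inv, mul_inv, h3]
  field_simp

/-- Coefficients of the partial fraction expansions of the elementary factors
`∏_{1 ≤ j ≤ n} (t - k n - j) / ∏_{s ≤ n} (t + s)` for `k < r` and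
`n! / ∏_{s ≤ n} (t + s)` for `r ≤ k`. -/
def rivoalCoeff (r n k s : ℕ) : ℤ :=
  if k < r then (-1) ^ (n + s) * n.choose s * (s + k * n + n).choose n else (-1) ^ s * n.choose s

/-- The rational function
`n! ^ (a + 1 - r) * (t - 1) ⋯ (t - r n) / (t (t + 1) ⋯ (t + n)) ^ (a + 1)`. -/
noncomputable def rivoalFun (r n a : ℕ) (t : ℝ) : ℝ :=
  ∏ k ∈ Finset.range (a + 1), ∑ s ∈ Finset.range (n + 1), (rivoalCoeff r n k s : ℝ) / (t + s)

lemma sum_rivoalCoeff_of_lt {r n k : ℕ} (hk : k < r) {t : ℝ} (ht : 0 < t) :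
    ∑ s ∈ Finset.range (n + 1), (rivoalCoeff r n k s : ℝ) / (t + s) =
      (∏ j ∈ Finset.range n, (t - 1 - (k * n + j : ℕ))) /
        ∏ s ∈ Finset.range (n + 1), (t + s) := by
  let P : Polynomial ℝ :=
    ∏ j ∈ Finset.range n, (Polynomial.X - Polynomial.C (((k * n + j : ℕ) : ℝ) + 1))
  have hdeg : P.degree < (n + 1 : ℕ) := by
    simp only [P]
    rw [Polynomial.degree_prod]
    simp only [Polynomial.degree_X_sub_C, Finset.sum_const, Finset.card_range, nsmul_eq_mul,
      mul_one]
    exact_mod_cast Nat.lt_succ_self n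
  have heval (x : ℝ) : P.eval x = ∏ j ∈ Finset.range n, (x - 1 - (k * n + j : ℕ)) := by
    simp only [P, Polynomial.eval_prod]
    refine Finset.prod_congr rfl fun j _ => ?_
    simp only [Polynomial.eval_sub, Polynomial.eval_X, Polynomial.eval_C]
    ring
  rw [← heval, eval_div_prod_range n P hdeg ht]
  refine Finset.sum_congr rfl fun s hs => ?_
  congr 1
  have hs' : s ≤ n := Nat.lt_succ_iff.1 (Finset.mem_range.1 hs)
  have hP : P.eval (-(s : ℝ)) = (-1) ^ n * (n.factorial * (s + k * n + n).choose n : ℕ) := by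
    rw [heval, ← Nat.ascFactorial_eq_factorial_mul_choose, Nat.ascFactorial_eq_prod_range]
    push_cast
    rw [← Finset.card_range n, ← Finset.prod_const, Finset.card_range, ← Finset.prod_mul_distrib]
    exact Finset.prod_congr rfl fun j _ => by ring
  rw [rivoalCoeff, if_pos hk, hP]
  push_cast
  rw [Nat.cast_choose ℝ hs', pow_add]
  ring

lemma sum_rivoalCoeff_of_le {r n k : ℕ} (hk : r ≤ k) {t : ℝ} (ht : 0 < t) :
    ∑ s ∈ Finset.range (n + 1), (rivoalCoeff r n k s : ℝ) / (t + s) =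
      n.factorial / ∏ s ∈ Finset.range (n + 1), (t + s) := by
  have h := eval_div_prod_range n (Polynomial.C (n.factorial : ℝ))
    (lt_of_le_of_lt Polynomial.degree_C_le (by exact_mod_cast Nat.succ_pos n)) ht
  rw [Polynomial.eval_C] at h
  rw [h]
  refine Finset.sum_congr rfl fun s hs => ?_
  congr 1
  have hs' : s ≤ n := Nat.lt_succ_iff.1 (Finset.mem_range.1 hs)
  rw [rivoalCoeff, if_neg (not_lt.2 hk), Polynomial.eval_C]
  push_cast
  rw [Nat.cast_choose ℝ hs']
  ring

lemma prod_range_prod_range_mul_add (g : ℕ → ℝ) (r n : ℕ) :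
    ∏ k ∈ Finset.range r, ∏ j ∈ Finset.range n, g (k * n + j) =
      ∏ i ∈ Finset.range (r * n), g i := by
  induction r with
  | zero => simp
  | succ r ih => rw [Finset.prod_range_succ, ih, Nat.succ_mul, Finset.prod_range_add]

lemma factorial_div_prod_range (x n : ℕ) :
    (n.factorial : ℝ) / ∏ s ∈ Finset.range (n + 1), ((x : ℝ) + 1 + s) = natBeta x n := by
  have h : ((x.factorial : ℕ) : ℝ) * ∏ s ∈ Finset.range (n + 1), ((x : ℝ) + 1 + s) =
      ((x + n + 1).factorial : ℕ) := by
    rw [add_assoc, ← Nat.factorial_mul_ascFactorial, Nat.ascFactorial_eq_prod_range]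
    push_cast
    rfl
  have hx : (x.factorial : ℝ) ≠ 0 := by positivity
  rw [natBeta, ← h, mul_div_mul_left _ _ hx]

lemma rivoalFun_natCast_add_one {r n a : ℕ} (hr : r ≤ a + 1) (x : ℕ) :
    rivoalFun r n a (x + 1) =
      x.descFactorial (r * n) / (n.factorial : ℝ) ^ r * natBeta x n ^ (a + 1) := by
  have ht : (0 : ℝ) < x + 1 := by positivity
  rw [rivoalFun, ← Finset.prod_range_mul_prod_Ico _ hr]
  have h1 : ∏ k ∈ Finset.range r,
      ∑ s ∈ Finset.range (n + 1), (rivoalCoeff r n k s : ℝ) / ((x : ℝ) + 1 + s) =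
      x.descFactorial (r * n) / (n.factorial : ℝ) ^ r * natBeta x n ^ r := by
    rw [Finset.prod_congr rfl fun k hk => sum_rivoalCoeff_of_lt (Finset.mem_range.1 hk) ht]
    simp only [add_sub_cancel_right]
    rw [Finset.prod_div_distrib, prod_range_prod_range_mul_add (fun i => (x : ℝ) - i),
      ← descPochhammer_eval_eq_prod_range, descPochhammer_eval_eq_descFactorial,
      Finset.prod_const, Finset.card_range, ← factorial_div_prod_range, div_pow]
    have : (n.factorial : ℝ) ^ r ≠ 0 := by positivity
    field_simp
  have h2 : ∏ k ∈ Finset.Ico r (a + 1),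
      ∑ s ∈ Finset.range (n + 1), (rivoalCoeff r n k s : ℝ) / ((x : ℝ) + 1 + s) =
      natBeta x n ^ (a + 1 - r) := by
    rw [Finset.prod_congr rfl fun k hk => sum_rivoalCoeff_of_le (Finset.mem_Ico.1 hk).1 ht,
      Finset.prod_const, Nat.card_Ico, factorial_div_prod_range]
  rw [h1, h2, mul_assoc, ← pow_add, Nat.add_sub_cancel' hr]

lemma tsum_rivoalFun {r n a : ℕ} (hr : r ≤ a + 1) (w : ℝ) :
    ∑' k : ℕ, rivoalFun r n a (k + 1) * w ^ (k + 1) =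
      w ^ (r * n + 1) * ((r * n).factorial / (n.factorial : ℝ) ^ r) *
        ∑' m : ℕ, ((m + r * n).choose (r * n) * w ^ m) * natBeta (r * n + m) n ^ (a + 1) := by
  have hsupp : (Function.support fun k : ℕ => rivoalFun r n a (k + 1) * w ^ (k + 1)) ⊆
      Set.range fun m : ℕ => r * n + m := by
    intro k hk
    by_contra hcon
    refine hk ?_
    have hlt : k < r * n := by
      by_contra! h
      exact hcon ⟨k - r * n, by dsimp only; omega⟩
    simp only
    rw [rivoalFun_natCast_add_one hr, Nat.descFactorial_eq_zero_iff_lt.2 hlt]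
    simp
  rw [← (add_right_injective (r * n)).tsum_eq hsupp, ← tsum_mul_left]
  refine tsum_congr fun m => ?_
  rw [rivoalFun_natCast_add_one hr, Nat.descFactorial_eq_factorial_mul_choose,
    add_comm m, pow_add, pow_succ, pow_succ w, pow_add w]
  push_cast
  ring

lemma choose_mul_le (r n : ℕ) :
    ((r * n).choose n : ℝ) ≤ (r * Real.exp 1) ^ n := by
  calc ((r * n).choose n : ℝ) ≤ ((r * n : ℕ) : ℝ) ^ n / n.factorial := Nat.choose_le_pow_div _ _
    _ = (r : ℝ) ^ n * ((n : ℝ) ^ n / n.factorial) := by push_cast; rw [mul_pow]; ring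
    _ ≤ (r : ℝ) ^ n * Real.exp n := by
        gcongr
        exact Real.pow_div_factorial_le_exp (n : ℝ) (Nat.cast_nonneg n) n
    _ = _ := by rw [mul_pow, ← Real.exp_nat_mul, mul_one]

lemma sum_abs_rivoalCoeff_le (r n k : ℕ) :
    ∑ s ∈ Finset.range (n + 1), |(rivoalCoeff r n k s : ℝ)| ≤
      2 ^ n * if k < r then (((r : ℝ) + 1) * Real.exp 1) ^ n else 1 := by
  have hsum : ∑ s ∈ Finset.range (n + 1), (n.choose s : ℝ) = 2 ^ n := by
    exact_mod_cast Nat.sum_range_choose n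
  split_ifs with h
  · rw [← hsum, Finset.sum_mul]
    refine Finset.sum_le_sum fun s hs => ?_
    rw [rivoalCoeff, if_pos h]
    push_cast
    rw [abs_mul, abs_mul, abs_pow, abs_neg, abs_one, one_pow, one_mul, Nat.abs_cast, Nat.abs_cast]
    refine mul_le_mul_of_nonneg_left ?_ (Nat.cast_nonneg _)
    have hle : s + k * n + n ≤ (r + 1) * n := by
      have hs' : s ≤ n := Nat.lt_succ_iff.1 (Finset.mem_range.1 hs)
      nlinarith
    have h1 := choose_mul_le (r + 1) n
    push_cast at h1
    refine le_trans ?_ h1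
    exact_mod_cast Nat.choose_le_choose n hle
  · rw [← hsum, mul_one]
    refine Finset.sum_le_sum fun s _ => ?_
    rw [rivoalCoeff, if_neg h]
    push_cast
    rw [abs_mul, abs_pow, abs_neg, abs_one, one_pow, one_mul, Nat.abs_cast]

lemma prod_sum_abs_rivoalCoeff_le {r n a : ℕ} (hr : r ≤ a + 1) :
    ∏ k ∈ Finset.range (a + 1), ∑ s ∈ Finset.range (n + 1), |(rivoalCoeff r n k s : ℝ)| ≤
      (2 ^ (a + 1) * (((r : ℝ) + 1) * Real.exp 1) ^ r) ^ n := by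
  refine (Finset.prod_le_prod (fun _ _ => Finset.sum_nonneg fun _ _ => abs_nonneg _)
    fun k _ => sum_abs_rivoalCoeff_le r n k).trans (le_of_eq ?_)
  rw [Finset.prod_mul_distrib, Finset.prod_const, Finset.card_range,
    ← Finset.prod_range_mul_prod_Ico _ hr,
    Finset.prod_congr rfl fun k hk => if_pos (Finset.mem_range.1 hk),
    Finset.prod_congr (s₁ := Finset.Ico r (a + 1)) rfl
      fun k hk => if_neg (not_lt.2 (Finset.mem_Ico.1 hk).1),
    Finset.prod_const, Finset.card_range, Finset.prod_const_one, mul_one]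
  generalize ((r : ℝ) + 1) * Real.exp 1 = E
  rw [mul_pow (2 ^ (a + 1) : ℝ), ← pow_mul, ← pow_mul, ← pow_mul, ← pow_mul, mul_comm n, mul_comm n]

lemma sum_log_eq_sum_psi (N : ℕ) :
    ∑ n ∈ Finset.Ioc 0 N, Real.log n = ∑ k ∈ Finset.Ioc 0 N, Chebyshev.psi ((N / k : ℕ) : ℝ) := by
  have h := ArithmeticFunction.sum_Ioc_mul_eq_sum_sum
    (ArithmeticFunction.zeta : ArithmeticFunction ℝ) ArithmeticFunction.vonMangoldt N
  rw [ArithmeticFunction.zeta_mul_vonMangoldt] at h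
  simp only [ArithmeticFunction.log_apply] at h
  rw [h]
  refine Finset.sum_congr rfl fun k hk => ?_
  have hk0 : k ≠ 0 := (Finset.mem_Ioc.1 hk).1.ne'
  rw [Chebyshev.psi, Nat.floor_natCast, ArithmeticFunction.natCoe_apply,
    ArithmeticFunction.zeta_apply_ne hk0, Nat.cast_one, one_mul]

/-- Chebyshev's bound `liminf ψ(n) / n ≤ 1`. -/
lemma exists_psi_lt {e : ℝ} (he : 0 < e) (n₁ : ℕ) :
    ∃ n, n₁ ≤ n ∧ Chebyshev.psi (n : ℝ) < (1 + e) * n := by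
  by_contra! hcon
  wlog hn₁ : 1 ≤ n₁ generalizing n₁
  · exact this 1 (fun n hn => hcon n (by omega)) le_rfl
  obtain ⟨M, hM⟩ : ∃ M : ℕ, 1 ≤ M ∧ Real.log n₁ + (1 + e) < e * Real.log M := by
    have ht : Filter.Tendsto (fun M : ℕ => e * Real.log M) Filter.atTop Filter.atTop :=
      (Real.tendsto_log_atTop.comp tendsto_natCast_atTop_atTop).const_mul_atTop he
    exact ((Filter.eventually_ge_atTop 1).and (ht.eventually_gt_atTop _)).exists
  obtain ⟨hM1, hM⟩ := hM
  have hn₁' : (1 : ℝ) ≤ n₁ := by exact_mod_cast hn₁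
  have hM1' : (1 : ℝ) ≤ M := by exact_mod_cast hM1
  have hup : ∑ n ∈ Finset.Ioc 0 (n₁ * M), Real.log n ≤
      (n₁ * M : ℝ) * (Real.log n₁ + Real.log M) := by
    calc ∑ n ∈ Finset.Ioc 0 (n₁ * M), Real.log n
        ≤ ∑ n ∈ Finset.Ioc 0 (n₁ * M), Real.log ((n₁ * M : ℕ) : ℝ) := by
          refine Finset.sum_le_sum fun n hn => ?_
          obtain ⟨h0, h1⟩ := Finset.mem_Ioc.1 hn
          exact Real.log_le_log (by exact_mod_cast h0) (by exact_mod_cast h1)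
      _ = _ := by
          rw [Finset.sum_const, Nat.card_Ioc, nsmul_eq_mul]
          push_cast
          rw [Real.log_mul (by positivity) (by positivity)]
          norm_num
  have hlow : (1 + e) * ((n₁ * M : ℝ) * Real.log M - M) ≤
      ∑ n ∈ Finset.Ioc 0 (n₁ * M), Real.log n := by
    rw [sum_log_eq_sum_psi]
    have hsub : Finset.Ioc 0 M ⊆ Finset.Ioc 0 (n₁ * M) :=
      Finset.Ioc_subset_Ioc_right (Nat.le_mul_of_pos_left M hn₁)
    refine le_trans ?_ (Finset.sum_le_sum_of_subset_of_nonneg hsub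
      fun _ _ _ => Chebyshev.psi_nonneg _)
    have hharm : Real.log M ≤ ∑ k ∈ Finset.Ioc 0 M, (k : ℝ)⁻¹ := by
      have h1 := log_add_one_le_harmonic M
      rw [harmonic_eq_sum_Icc] at h1
      push_cast at h1
      refine le_trans (Real.log_le_log (by positivity) (by linarith)) h1
    calc (1 + e) * ((n₁ * M : ℝ) * Real.log M - M)
        ≤ (1 + e) * ((n₁ * M : ℝ) * ∑ k ∈ Finset.Ioc 0 M, (k : ℝ)⁻¹ - M) := by gcongr
      _ = ∑ k ∈ Finset.Ioc 0 M, (1 + e) * ((n₁ * M : ℝ) * (k : ℝ)⁻¹ - 1) := by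
          rw [← Finset.mul_sum, Finset.sum_sub_distrib, ← Finset.mul_sum]
          simp
      _ ≤ _ := by
          refine Finset.sum_le_sum fun k hk => ?_
          obtain ⟨h0, h1⟩ := Finset.mem_Ioc.1 hk
          have hle : n₁ ≤ n₁ * M / k := (Nat.le_div_iff_mul_le h0).2 (Nat.mul_le_mul_left _ h1)
          refine le_trans ?_ (hcon _ hle)
          gcongr
          have h2 := Nat.lt_div_mul_add (a := n₁ * M) h0
          have h0' : (0 : ℝ) < k := by exact_mod_cast h0
          have h2' : (n₁ * M : ℝ) < ((n₁ * M / k : ℕ) : ℝ) * k + k := by exact_mod_cast h2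
          rw [← div_eq_mul_inv, sub_le_iff_le_add, div_le_iff₀ h0']
          linarith
  have hkey := hlow.trans hup
  have hM0 : (0 : ℝ) < M := by linarith
  have h3 : (1 + e) * (n₁ * Real.log M - 1) ≤ n₁ * (Real.log n₁ + Real.log M) := by
    refine le_of_mul_le_mul_right ?_ hM0
    linarith
  nlinarith [mul_le_mul_of_nonneg_left hM.le (sub_nonneg.2 hn₁')]

lemma exists_lcmUpto_le {e : ℝ} (he : 0 < e) (n₁ : ℕ) :
    ∃ n, n₁ ≤ n ∧ (Nat.lcmUpto n : ℝ) ≤ Real.exp ((1 + e) * n) := by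
  obtain ⟨n, hn, h⟩ := exists_psi_lt he n₁
  refine ⟨n, hn, ?_⟩
  rw [Chebyshev.psi_eq_log_lcmUpto] at h
  exact (Real.log_le_iff_le_exp (by exact_mod_cast Nat.lcmUpto_pos n)).1 h.le

lemma natBeta_succ_left (b n : ℕ) :
    natBeta (b + 1) n = natBeta b n * ((b + 1 : ℝ) / (b + n + 2)) := by
  unfold natBeta
  rw [show b + 1 + n + 1 = b + n + 1 + 1 by ring, Nat.factorial_succ b,
    Nat.factorial_succ (b + n + 1)]
  push_cast
  field_simp
  ring

lemma natBeta_succ_right_eq_mul (b n : ℕ) :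
    natBeta b (n + 1) = natBeta b n * ((n + 1 : ℝ) / (b + n + 2)) := by
  unfold natBeta
  rw [show b + (n + 1) + 1 = b + n + 1 + 1 by ring, Nat.factorial_succ n,
    Nat.factorial_succ (b + n + 1)]
  push_cast
  field_simp
  ring

lemma natBeta_add_left_ge {b n : ℕ} (h : n ≤ b) (i : ℕ) :
    (1 / 2) ^ i * natBeta b n ≤ natBeta (b + i) n := by
  induction i with
  | zero => simp
  | succ i ih =>
    rw [← add_assoc, natBeta_succ_left, pow_succ, mul_right_comm]
    have h' : (n : ℝ) ≤ b := by exact_mod_cast h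
    refine mul_le_mul ih ?_ (by norm_num) (natBeta_pos _ _).le
    push_cast
    rw [div_le_div_iff₀ (by norm_num) (by positivity)]
    linarith [(Nat.cast_nonneg i : (0 : ℝ) ≤ i)]

lemma natBeta_mul_succ_ge {r : ℕ} (hr : 1 ≤ r) (n : ℕ) :
    (1 / 2) ^ r / (r + 2) * natBeta (r * n) n ≤ natBeta (r * (n + 1)) (n + 1) := by
  rw [natBeta_succ_right_eq_mul, mul_add_one]
  have h1 := natBeta_add_left_ge (Nat.le_mul_of_pos_left n hr) r
  have h2 : (1 : ℝ) / (r + 2) ≤ (n + 1 : ℝ) / ((r * n + r : ℕ) + n + 2) := by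
    push_cast
    rw [div_le_div_iff₀ (by positivity) (by positivity)]
    nlinarith [(Nat.cast_nonneg n : (0 : ℝ) ≤ n)]
  calc (1 / 2 : ℝ) ^ r / (r + 2) * natBeta (r * n) n
      = (1 / 2) ^ r * natBeta (r * n) n * (1 / (r + 2)) := by ring
    _ ≤ _ := mul_le_mul h1 h2 (by positivity) (natBeta_pos _ _).le

lemma natBeta_mul_le (r n : ℕ) : natBeta (r * n) n ≤ (1 / (r + 1 : ℝ)) ^ n := by
  have h : n.factorial * (r + 1) ^ n ≤ (r * n + 1).ascFactorial n := by
    rw [Nat.ascFactorial_eq_prod_range, ← Finset.prod_range_add_one_eq_factorial]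
    calc (∏ i ∈ Finset.range n, (i + 1)) * (r + 1) ^ n
        = ∏ i ∈ Finset.range n, (i + 1) * (r + 1) := by
          rw [Finset.prod_mul_distrib, Finset.prod_const, Finset.card_range]
      _ ≤ _ := by
          refine Finset.prod_le_prod' fun i hi => ?_
          have := Finset.mem_range.1 hi
          nlinarith
  have h2 : (r * n).factorial * n.factorial * (r + 1) ^ n ≤ (r * n + n + 1).factorial := by
    calc (r * n).factorial * n.factorial * (r + 1) ^ n
        = (r * n).factorial * (n.factorial * (r + 1) ^ n) := by ring
      _ ≤ (r * n).factorial * (r * n + 1).ascFactorial n := by gcongr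
      _ = (r * n + n).factorial := Nat.factorial_mul_ascFactorial _ _
      _ ≤ _ := Nat.factorial_le (Nat.le_succ _)
  rw [natBeta, one_div, inv_pow, div_le_iff₀ (by positivity), inv_mul_eq_div,
    le_div_iff₀ (by positivity)]
  exact_mod_cast h2

lemma factorial_mul_div_pow_le (r n : ℕ) :
    ((r * n).factorial : ℝ) / (n.factorial : ℝ) ^ r ≤ ((r * Real.exp 1) ^ r) ^ n := by
  calc ((r * n).factorial : ℝ) / (n.factorial : ℝ) ^ r
      ≤ ((r * n : ℕ) : ℝ) ^ (r * n) / (n.factorial : ℝ) ^ r := by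
        gcongr
        exact_mod_cast Nat.factorial_le_pow (r * n)
    _ = (r : ℝ) ^ (r * n) * ((n : ℝ) ^ n / n.factorial) ^ r := by
        push_cast
        rw [mul_pow, div_pow, ← pow_mul (n : ℝ), mul_comm n r]
        ring
    _ ≤ (r : ℝ) ^ (r * n) * Real.exp n ^ r := by
        gcongr
        exact Real.pow_div_factorial_le_exp (n : ℝ) (Nat.cast_nonneg n) n
    _ = _ := by
        rw [mul_pow, mul_pow, ← pow_mul, ← Real.exp_nat_mul, ← Real.exp_nat_mul,
          ← Real.exp_nat_mul]
        congr 2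
        ring

lemma factorial_mul_div_pow_le_succ {r : ℕ} (hr : 1 ≤ r) (n : ℕ) :
    ((r * n).factorial : ℝ) / (n.factorial : ℝ) ^ r ≤
      ((r * (n + 1)).factorial : ℝ) / ((n + 1).factorial : ℝ) ^ r := by
  rw [div_le_div_iff₀ (by positivity) (by positivity)]
  have h : (r * n).factorial * (n + 1) ^ r ≤ (r * (n + 1)).factorial := by
    refine le_trans ?_ (Nat.factorial_mul_pow_le_factorial (m := r * n) (n := r))
    gcongr
    exact Nat.le_mul_of_pos_left n hr
  have := Nat.mul_le_mul_right (n.factorial ^ r) h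
  rw [mul_assoc, ← mul_pow, ← Nat.factorial_succ] at this
  exact_mod_cast this

/-- The series `∑_{k ≥ 1} R(k) w ^ k` attached to `R = rivoalFun r n a`. -/
noncomputable def rivoalSeries (r n a : ℕ) (w : ℝ) : ℝ :=
  ∑' k : ℕ, rivoalFun r n a (k + 1) * w ^ (k + 1)

/-- The order of magnitude of `rivoalSeries r n a w`. -/
noncomputable def rivoalSize (r n a : ℕ) (w : ℝ) : ℝ :=
  |w| ^ (r * n + 1) * ((r * n).factorial / (n.factorial : ℝ) ^ r) * natBeta (r * n) n ^ (a + 1)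

lemma rivoalSize_pos (r n a : ℕ) {w : ℝ} (hw0 : w ≠ 0) : 0 < rivoalSize r n a w := by
  have := natBeta_pos (r * n) n
  unfold rivoalSize
  positivity

lemma abs_rivoalSeries_bounds {r n a : ℕ} (hr : r ≤ a + 1) {w : ℝ} (hw : |w| < 1) :
    (1 / 2) ^ (r * n + 1) * rivoalSize r n a w ≤ |rivoalSeries r n a w| ∧
      |rivoalSeries r n a w| ≤ (1 / (1 - |w|)) ^ (r * n + 1) * rivoalSize r n a w := by
  obtain ⟨h1, h2⟩ := choose_tsum_bounds (r * n) n (a + 1) (r * n) hw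
  have hb := natBeta_pos (r * n) n
  have hpos : 0 ≤ ∑' m : ℕ,
      (((m + r * n).choose (r * n) : ℝ) * w ^ m) * natBeta (r * n + m) n ^ (a + 1) :=
    le_trans (by positivity) h1
  rw [rivoalSeries, tsum_rivoalFun hr, abs_mul, abs_mul, abs_pow, abs_of_nonneg hpos,
    abs_of_nonneg (by positivity : (0 : ℝ) ≤ (r * n).factorial / (n.factorial : ℝ) ^ r), rivoalSize]
  have hA : 0 ≤ |w| ^ (r * n + 1) * ((r * n).factorial / (n.factorial : ℝ) ^ r) := by positivity
  constructor
  · linarith [mul_le_mul_of_nonneg_left h1 hA]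
  · linarith [mul_le_mul_of_nonneg_left h2 hA]

lemma rivoalSize_succ_ge {r : ℕ} (hr : 1 ≤ r) (n a : ℕ) (w : ℝ) :
    |w| ^ r * ((1 / 2) ^ r / (r + 2)) ^ (a + 1) * rivoalSize r n a w ≤
      rivoalSize r (n + 1) a w := by
  have hb := natBeta_pos (r * n) n
  calc |w| ^ r * ((1 / 2) ^ r / (r + 2)) ^ (a + 1) * rivoalSize r n a w
      = |w| ^ (r * (n + 1) + 1) * ((r * n).factorial / (n.factorial : ℝ) ^ r) *
          ((1 / 2) ^ r / (r + 2) * natBeta (r * n) n) ^ (a + 1) := by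
        rw [rivoalSize, mul_pow _ (natBeta (r * n) n), mul_add_one, add_right_comm, pow_add _ _ r]
        ring
    _ ≤ _ := by
        refine mul_le_mul (mul_le_mul_of_nonneg_left (factorial_mul_div_pow_le_succ hr n)
          (by positivity)) ?_ (by positivity) (by positivity)
        exact pow_le_pow_left₀ (by positivity) (natBeta_mul_succ_ge hr n) _

lemma abs_rivoalSeries_le {r n a : ℕ} (hr : r ≤ a + 1) {w : ℝ} (hw : |w| < 1) :
    |rivoalSeries r n a w| ≤ 1 / (1 - |w|) *
      ((r * Real.exp 1 / (1 - |w|)) ^ r / (r + 1) ^ (a + 1)) ^ n := by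
  have hw' : 0 < 1 - |w| := by linarith
  have hb := natBeta_pos (r * n) n
  calc |rivoalSeries r n a w|
      ≤ (1 / (1 - |w|)) ^ (r * n + 1) * rivoalSize r n a w := (abs_rivoalSeries_bounds hr hw).2
    _ ≤ (1 / (1 - |w|)) ^ (r * n + 1) *
          (1 * ((r * Real.exp 1) ^ r) ^ n * ((1 / (r + 1 : ℝ)) ^ n) ^ (a + 1)) := by
        unfold rivoalSize
        gcongr
        · exact pow_le_one₀ (abs_nonneg _) hw.le
        · exact factorial_mul_div_pow_le r n
        · exact natBeta_mul_le r n
    _ = _ := by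
        rw [div_eq_mul_one_div (r * Real.exp 1 : ℝ), div_eq_mul_one_div _ ((r + 1 : ℝ) ^ (a + 1)),
          ← one_div_pow]
        ring

lemma rivoalSeries_ne_zero {r a : ℕ} (n : ℕ) (hr : r ≤ a + 1) {w : ℝ} (hw : |w| < 1)
    (hw0 : w ≠ 0) : rivoalSeries r n a w ≠ 0 := by
  have h := (abs_rivoalSeries_bounds (n := n) hr hw).1
  have := rivoalSize_pos r n a hw0
  exact abs_pos.1 (lt_of_lt_of_le (by positivity) h)

/-- Consecutive values of `rivoalSeries` do not decrease too fast. -/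
lemma exists_mul_abs_rivoalSeries_le {r a : ℕ} (hr : 1 ≤ r) (hra : r ≤ a + 1) {w : ℝ}
    (hw : |w| < 1) (hw0 : w ≠ 0) :
    ∃ c : ℝ, 0 < c ∧ ∀ n, c * (((1 - |w|) / 2) ^ r) ^ n * |rivoalSeries r n a w| ≤
      |rivoalSeries r (n + 1) a w| := by
  have hw' : 0 < 1 - |w| := by linarith
  refine ⟨(1 - |w|) * (1 / 2) ^ (r + 1) * (|w| ^ r * ((1 / 2) ^ r / (r + 2)) ^ (a + 1)),
    by positivity, fun n => ?_⟩
  have h1 := (abs_rivoalSeries_bounds (n := n) hra hw).2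
  have h2 := (abs_rivoalSeries_bounds (n := n + 1) hra hw).1
  have h3 := rivoalSize_succ_ge hr n a w
  set K : ℝ := |w| ^ r * ((1 / 2) ^ r / (r + 2)) ^ (a + 1) with hK
  have hK0 : 0 < K := by positivity
  calc (1 - |w|) * (1 / 2) ^ (r + 1) * K * (((1 - |w|) / 2) ^ r) ^ n * |rivoalSeries r n a w|
      ≤ (1 - |w|) * (1 / 2) ^ (r + 1) * K * (((1 - |w|) / 2) ^ r) ^ n *
          ((1 / (1 - |w|)) ^ (r * n + 1) * rivoalSize r n a w) := by gcongr
    _ = (1 / 2) ^ (r * (n + 1) + 1) * (K * rivoalSize r n a w) := by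
        rw [mul_add_one, ← pow_mul, div_pow, div_pow, div_pow, div_pow, pow_succ (1 - |w|)]
        field_simp
        ring
    _ ≤ (1 / 2) ^ (r * (n + 1) + 1) * rivoalSize r (n + 1) a w := by gcongr
    _ ≤ _ := h2

/-- The rational span of `1, Li₁(w), …, Li_ℓ(w)`. -/
noncomputable def polylogSpan (w : ℝ) (ℓ : ℕ) : Submodule ℚ ℝ :=
  Submodule.span ℚ (({1} : Set ℝ) ∪ {x : ℝ | ∃ j : ℕ, 1 ≤ j ∧ j ≤ ℓ ∧ x = Li j w})

instance finiteDimensional_polylogSpan (w : ℝ) (ℓ : ℕ) :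
    FiniteDimensional ℚ (polylogSpan w ℓ) := by
  refine FiniteDimensional.span_of_finite ℚ ((Set.finite_singleton _).union ?_)
  refine ((Set.finite_Iic ℓ).image fun j => Li j w).subset ?_
  rintro x ⟨j, _, hj, rfl⟩
  exact ⟨j, hj, rfl⟩

lemma one_le_of_frequently_one_le_mul_pow {C B : ℝ} (hB : 0 ≤ B)
    (h : ∀ N : ℕ, ∃ n, N ≤ n ∧ 1 ≤ C * B ^ n) : 1 ≤ B := by
  by_contra! hB1
  have ht : Filter.Tendsto (fun n : ℕ => C * B ^ n) Filter.atTop (nhds (C * 0)) :=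
    (tendsto_pow_atTop_nhds_zero_of_lt_one hB hB1).const_mul C
  rw [mul_zero] at ht
  obtain ⟨N, hN⟩ := Filter.eventually_atTop.1 (ht.eventually_lt_const zero_lt_one)
  obtain ⟨n, hn, h1⟩ := h N
  exact absurd (hN n hn) (not_lt.2 h1)

lemma abs_one_div_rat_lt_one {z : ℚ} (hz : 1 < |z|) :
    |1 / (z : ℝ)| < 1 ∧ 1 / (z : ℝ) ≠ 0 := by
  have hz' : (1 : ℝ) < |(z : ℝ)| := by exact_mod_cast hz
  have hz0 : (z : ℝ) ≠ 0 := abs_pos.1 (by linarith)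
  refine ⟨?_, one_div_ne_zero hz0⟩
  rw [abs_div, abs_one]
  exact (div_lt_one (by linarith)).2 hz'

/-- The integral linear forms in `1, Li₁(1/z), …, Li_{a+1}(1/z)` obtained from `rivoalSeries`. -/
lemma exists_linearForm_rivoalSeries {z : ℚ} (hz : 1 < |z|) {r a : ℕ} (hra : r ≤ a + 1) (n : ℕ) :
    ∃ A : ℕ → ℤ,
      (Nat.lcmUpto n : ℝ) ^ (a + 1) * (z.den : ℝ) ^ n * rivoalSeries r n a (1 / (z : ℝ)) =
        ∑ j ∈ Finset.range (a + 2), A j * (if j = 0 then 1 else Li j (1 / (z : ℝ))) ∧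
      ∀ j ∈ Finset.range (a + 2), |(A j : ℝ)| ≤ (a + 1).factorial * (Nat.lcmUpto n : ℝ) ^ (a + 1) *
        (2 * |(z.num : ℝ)| * (2 ^ (a + 1) * (((r : ℝ) + 1) * Real.exp 1) ^ r)) ^ n := by
  have hd : ∀ m : ℕ, 1 ≤ m → m ≤ n → m ∣ Nat.lcmUpto n := fun m h1 h2 =>
    Finset.dvd_lcm (f := id) (Finset.mem_Icc.2 ⟨h1, h2⟩)
  have hpf := (HasPartialFractions.prod hd (rivoalCoeff r n) a).mono
    (mul_le_mul_of_nonneg_left (prod_sum_abs_rivoalCoeff_le hra) (Nat.cast_nonneg _))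
  obtain ⟨A, hA, hA'⟩ := HasPartialFractions.exists_linearForm (f := rivoalFun r n a) hd hpf hz
  refine ⟨A, hA, fun j hj => (hA' j hj).trans ?_⟩
  have h2 : (n + 1 : ℝ) ≤ 2 ^ n := by exact_mod_cast Nat.lt_two_pow_self
  calc (Nat.lcmUpto n : ℝ) ^ (a + 1) * |(z.num : ℝ)| ^ n *
        ((n + 1) * ((a + 1).factorial * (2 ^ (a + 1) * (((r : ℝ) + 1) * Real.exp 1) ^ r) ^ n))
      ≤ (Nat.lcmUpto n : ℝ) ^ (a + 1) * |(z.num : ℝ)| ^ n *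
        (2 ^ n * ((a + 1).factorial * (2 ^ (a + 1) * (((r : ℝ) + 1) * Real.exp 1) ^ r) ^ n)) := by
        gcongr
    _ = _ := by rw [mul_pow (2 * |(z.num : ℝ)|), mul_pow 2 |(z.num : ℝ)|]; ring

lemma one_le_rivoal_base {z : ℚ} (hz : 1 < |z|) {r a : ℕ} (hr : 1 ≤ r) (hra : r ≤ a + 1)
    {e : ℝ} (he : 0 < e) :
    1 ≤ (Real.exp ((1 + e) * (a + 1)) *
          (2 * |(z.num : ℝ)| * (2 ^ (a + 1) * (((r : ℝ) + 1) * Real.exp 1) ^ r)) /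
          ((1 - |1 / (z : ℝ)|) / 2) ^ r) ^ Module.finrank ℚ (polylogSpan (1 / (z : ℝ)) (a + 1)) *
        (Real.exp ((1 + e) * (a + 1)) * (z.den : ℝ) *
          ((r * Real.exp 1 / (1 - |1 / (z : ℝ)|)) ^ r / (r + 1) ^ (a + 1))) := by
  obtain ⟨hw, hw0⟩ := abs_one_div_rat_lt_one hz
  choose A hA hA' using exists_linearForm_rivoalSeries hz hra
  have hnum : (1 : ℝ) ≤ |(z.num : ℝ)| :=
    le_trans (by exact_mod_cast z.den_pos) (den_lt_abs_num hz).le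
  have hden : (1 : ℝ) ≤ (z.den : ℝ) := by exact_mod_cast z.den_pos
  set w : ℝ := 1 / (z : ℝ) with hw_def
  set X : ℝ := 2 * |(z.num : ℝ)| * (2 ^ (a + 1) * (((r : ℝ) + 1) * Real.exp 1) ^ r) with hX
  set Y : ℝ := (r * Real.exp 1 / (1 - |w|)) ^ r / (r + 1) ^ (a + 1) with hY
  set ρ : ℝ := ((1 - |w|) / 2) ^ r with hρ
  set E : ℝ := Real.exp ((1 + e) * (a + 1)) with hE
  set D := Module.finrank ℚ (polylogSpan w (a + 1)) with hD
  have hw' : 0 < 1 - |w| := by linarith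
  have hX1 : 1 ≤ X := by
    have h1 : (1 : ℝ) ≤ 2 ^ (a + 1) := one_le_pow₀ (by norm_num)
    have h2 : (1 : ℝ) ≤ (((r : ℝ) + 1) * Real.exp 1) ^ r := by
      refine one_le_pow₀ (one_le_mul_of_one_le_of_one_le ?_ (Real.one_le_exp zero_le_one))
      linarith [(Nat.cast_nonneg r : (0 : ℝ) ≤ r)]
    exact one_le_mul_of_one_le_of_one_le (by linarith) (one_le_mul_of_one_le_of_one_le h1 h2)
  have hY0 : 0 ≤ Y := by positivity
  have hρ0 : 0 < ρ := by positivity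
  have hρ1 : ρ ≤ 1 := pow_le_one₀ (by positivity) (by linarith [abs_nonneg w])
  have hlcm1 (n : ℕ) : (1 : ℝ) ≤ Nat.lcmUpto n := by exact_mod_cast Nat.lcmUpto_pos n
  have hlcm (n : ℕ) : (Nat.lcmUpto n : ℝ) ≤ Nat.lcmUpto (n + 1) := by
    have : Nat.lcmUpto n ∣ Nat.lcmUpto (n + 1) :=
      Finset.lcm_dvd fun m hm => Finset.dvd_lcm (f := id)
        (Finset.Icc_subset_Icc_right (Nat.le_succ n) hm)
    exact_mod_cast Nat.le_of_dvd (Nat.lcmUpto_pos _) this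
  have hK1 : (1 : ℝ) ≤ (a + 1).factorial := by exact_mod_cast Nat.factorial_pos _
  obtain ⟨c, hc, hratio⟩ := exists_mul_abs_rivoalSeries_le hr hra hw hw0
  let L : ℕ → ℝ := fun n => (Nat.lcmUpto n : ℝ) ^ (a + 1) * (z.den : ℝ) ^ n * rivoalSeries r n a w
  let H : ℕ → ℝ := fun n => (a + 1).factorial * (Nat.lcmUpto n : ℝ) ^ (a + 1) * X ^ n
  have habsL (n : ℕ) :
      |L n| = (Nat.lcmUpto n : ℝ) ^ (a + 1) * (z.den : ℝ) ^ n * |rivoalSeries r n a w| := by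
    simp only [L]
    rw [abs_mul, abs_of_nonneg (by positivity)]
  obtain ⟨C, hC, hmain⟩ := one_le_mul_pow_finrank_mul_linearForm (polylogSpan w (a + 1))
    (fun j : Fin (a + 2) => if (j : ℕ) = 0 then 1 else Li j w)
    (fun j => by
      refine Submodule.subset_span ?_
      split_ifs with hj
      · exact Or.inl rfl
      · exact Or.inr ⟨j, by omega, by omega, rfl⟩)
    (fun n j => A n j) L H
    (fun n => by
      simp only [L]
      rw [hA n, Finset.sum_range])
    (fun n => by
      have h0 := rivoalSeries_ne_zero n hra hw hw0
      have h1 := hlcm1 n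
      simp only [L]
      positivity)
    (fun n j => hA' n j (Finset.mem_range.2 j.2))
    (monotone_nat_of_le_succ fun n => by
      have h1 := hlcm n
      simp only [H]
      gcongr
      omega)
    (fun n => one_le_mul_of_one_le_of_one_le
      (one_le_mul_of_one_le_of_one_le hK1 (one_le_pow₀ (hlcm1 n))) (one_le_pow₀ hX1))
    hc hρ0 hρ1
    (fun n => by
      rw [habsL, habsL]
      calc c * ρ ^ n * ((Nat.lcmUpto n : ℝ) ^ (a + 1) * (z.den : ℝ) ^ n * |rivoalSeries r n a w|)
          = (Nat.lcmUpto n : ℝ) ^ (a + 1) * (z.den : ℝ) ^ n *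
              (c * ρ ^ n * |rivoalSeries r n a w|) := by ring
        _ ≤ _ := by
            have h1 := hlcm n
            refine mul_le_mul ?_ (hratio n) (by positivity) (by positivity)
            gcongr
            omega)
  refine one_le_of_frequently_one_le_mul_pow
    (C := C * ((a + 1).factorial : ℝ) ^ D * (1 / (1 - |w|))) (by positivity) fun N => ?_
  obtain ⟨n, hn, hle⟩ := exists_lcmUpto_le he N
  refine ⟨n, hn, (hmain n).trans ?_⟩
  have hdE : (Nat.lcmUpto n : ℝ) ^ (a + 1) ≤ E ^ n := by
    refine (pow_le_pow_left₀ (Nat.cast_nonneg _) hle _).trans (le_of_eq ?_)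
    rw [hE, ← Real.exp_nat_mul, ← Real.exp_nat_mul]
    push_cast
    congr 1
    ring
  have hLle : |L n| ≤ E ^ n * (z.den : ℝ) ^ n * (1 / (1 - |w|) * Y ^ n) := by
    rw [habsL]
    gcongr
    exact abs_rivoalSeries_le hra hw
  calc C * (H n / ρ ^ n) ^ D * |L n|
      ≤ C * ((a + 1).factorial * E ^ n * X ^ n / ρ ^ n) ^ D *
          (E ^ n * (z.den : ℝ) ^ n * (1 / (1 - |w|) * Y ^ n)) := by
        simp only [H]
        gcongr
    _ = _ := by
        rw [mul_assoc ((a + 1).factorial : ℝ), ← mul_pow, mul_div_assoc, ← div_pow, mul_pow _ _ D,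
          ← pow_mul, mul_comm n D, pow_mul, mul_pow _ _ n, mul_pow _ _ n, mul_pow _ _ n]
        ring

lemma exists_mul_log_le_finrank_polylogSpan {z : ℚ} (hz : 1 < |z|) :
    ∃ K : ℝ, 0 ≤ K ∧ ∀ e : ℝ, 0 < e → ∀ r ℓ : ℕ, 1 ≤ r → r ≤ ℓ →
      ℓ * Real.log (r + 1) ≤ Module.finrank ℚ (polylogSpan (1 / (z : ℝ)) ℓ) *
        (ℓ * (1 + e + Real.log 2) + (r * (Real.log (r + 1) + K) + K)) +
          (ℓ * (1 + e) + (r * (Real.log (r + 1) + K) + K)) := by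
  obtain ⟨hw, hw0⟩ := abs_one_div_rat_lt_one hz
  have hnum : (1 : ℝ) ≤ |(z.num : ℝ)| :=
    le_trans (by exact_mod_cast z.den_pos) (den_lt_abs_num hz).le
  have hden : (1 : ℝ) ≤ (z.den : ℝ) := by exact_mod_cast z.den_pos
  have hbase := fun (r a : ℕ) (hr : 1 ≤ r) (hra : r ≤ a + 1) (e : ℝ) (he : 0 < e) =>
    one_le_rivoal_base hz hr hra he
  set w : ℝ := 1 / (z : ℝ) with hw_def
  set u : ℝ := 1 - |w| with hu
  have hu0 : 0 < u := by linarith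
  have hu1 : u ≤ 1 := by linarith [abs_nonneg w]
  set P : ℝ := |(z.num : ℝ)| with hP
  set q : ℝ := (z.den : ℝ) with hq
  have hP0 : 0 ≤ Real.log P := Real.log_nonneg hnum
  have hq0 : 0 ≤ Real.log q := Real.log_nonneg hden
  have hlu : 0 ≤ -Real.log u := by linarith [Real.log_nonpos hu0.le hu1]
  have hl2 : 0 ≤ Real.log 2 := Real.log_nonneg one_le_two
  refine ⟨Real.log P + Real.log q + 1 + Real.log 2 - Real.log u, by linarith,
    fun e he r ℓ hr hrℓ => ?_⟩
  obtain ⟨a, rfl⟩ : ∃ a, ℓ = a + 1 := ⟨ℓ - 1, by omega⟩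
  have h := Real.log_nonneg (hbase r a hr hrℓ e he)
  have hr0 : (1 : ℝ) ≤ r := by exact_mod_cast hr
  have hrne : (r : ℝ) ≠ 0 := by positivity
  have hPne : P ≠ 0 := by positivity
  have hqne : q ≠ 0 := by positivity
  have hr1 : (r : ℝ) + 1 ≠ 0 := by positivity
  have hune : u ≠ 0 := hu0.ne'
  have hE := Real.exp_ne_zero ((1 + e) * (a + 1))
  have hE1 := Real.exp_ne_zero 1
  have hu2 : u / 2 ≠ 0 := by positivity
  rw [Real.log_mul (by positivity) (by positivity), Real.log_pow,
    Real.log_div (by positivity) (by positivity), Real.log_mul hE (by positivity),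
    Real.log_mul (by positivity) (by positivity), Real.log_mul two_ne_zero hPne,
    Real.log_mul (by positivity) (by positivity), Real.log_pow, Real.log_pow, Real.log_pow,
    Real.log_mul hr1 hE1, Real.log_div hune two_ne_zero, Real.log_mul (by positivity) (by positivity),
    Real.log_mul hE hqne, Real.log_div (by positivity) (by positivity), Real.log_pow, Real.log_pow,
    Real.log_div (by positivity) hune, Real.log_mul hrne hE1, Real.log_exp, Real.log_exp] at h
  have hlr : Real.log r ≤ Real.log (r + 1) := Real.log_le_log (by positivity) (by linarith)
  push_cast at h ⊢
  set D : ℝ := (Module.finrank ℚ (polylogSpan w (a + 1)) : ℝ) with hD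
  have hD0 : 0 ≤ D := Nat.cast_nonneg _
  set T := Real.log ((r : ℝ) + 1) with hT
  have e1 : (1 + e) * ((a : ℝ) + 1) + (Real.log 2 + Real.log P + (((a : ℝ) + 1) * Real.log 2 +
      r * (T + 1))) - r * (Real.log u - Real.log 2) ≤
      ((a : ℝ) + 1) * (1 + e + Real.log 2) +
        (r * (T + (Real.log P + Real.log q + 1 + Real.log 2 - Real.log u)) +
          (Real.log P + Real.log q + 1 + Real.log 2 - Real.log u)) := by
    have : 0 ≤ r * (Real.log P + Real.log q) := by positivity
    linarith
  have e2 : r * (Real.log r + 1 - Real.log u) ≤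
      r * (T + (Real.log P + Real.log q + 1 + Real.log 2 - Real.log u)) := by
    gcongr
    linarith
  have e3 := mul_le_mul_of_nonneg_left e1 hD0
  linarith

lemma eventually_exists_floor_rpow {η K : ℝ} (hη : 0 < η) (hη1 : η < 1) (hK : 0 ≤ K) :
    ∀ᶠ ℓ : ℕ in Filter.atTop, ∃ r : ℕ, 1 ≤ r ∧ r ≤ ℓ ∧
      (1 - η) * Real.log ℓ ≤ Real.log (r + 1) ∧ r * (Real.log (r + 1) + K) + K ≤ η * ℓ := by
  have hlim : Filter.Tendsto
      (fun x : ℝ => Real.log x / x ^ η + (Real.log 2 + K) * x ^ (-η) + K * x⁻¹) Filter.atTop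
      (nhds 0) := by
    have h1 : Filter.Tendsto (fun x : ℝ => Real.log x / x ^ η) Filter.atTop (nhds 0) :=
      (isLittleO_log_rpow_atTop hη).tendsto_div_nhds_zero
    have h2 := (tendsto_rpow_neg_atTop hη).const_mul (Real.log 2 + K)
    have h3 := (tendsto_inv_atTop_zero (𝕜 := ℝ)).const_mul K
    simpa using (h1.add h2).add h3
  have hev := (hlim.comp tendsto_natCast_atTop_atTop).eventually_lt_const hη
  filter_upwards [hev, Filter.eventually_ge_atTop 1] with ℓ hℓ hℓ1
  have hℓ1' : (1 : ℝ) ≤ ℓ := by exact_mod_cast hℓ1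
  have hℓ0 : (0 : ℝ) < ℓ := by linarith
  have hpow1 : (1 : ℝ) ≤ (ℓ : ℝ) ^ (1 - η) := Real.one_le_rpow hℓ1' (by linarith)
  have hpowle : (ℓ : ℝ) ^ (1 - η) ≤ ℓ := by
    simpa using Real.rpow_le_rpow_of_exponent_le hℓ1' (show 1 - η ≤ 1 by linarith)
  set r := ⌊(ℓ : ℝ) ^ (1 - η)⌋₊ with hr
  have hrle : (r : ℝ) ≤ (ℓ : ℝ) ^ (1 - η) := Nat.floor_le (by linarith)
  have hrℓ : (r : ℝ) ≤ ℓ := hrle.trans hpowle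
  refine ⟨r, (Nat.one_le_floor_iff _).2 hpow1, by exact_mod_cast hrℓ, ?_, ?_⟩
  · rw [← Real.log_rpow hℓ0]
    exact Real.log_le_log (by linarith) (Nat.lt_floor_add_one _).le
  · have hlog : Real.log (r + 1) ≤ Real.log ℓ + Real.log 2 := by
      rw [← Real.log_mul hℓ0.ne' two_ne_zero]
      exact Real.log_le_log (by positivity) (by linarith)
    have hlog0 : 0 ≤ Real.log ℓ := Real.log_nonneg hℓ1'
    have hl2 : 0 ≤ Real.log 2 := Real.log_nonneg one_le_two
    calc r * (Real.log (r + 1) + K) + K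
        ≤ (ℓ : ℝ) ^ (1 - η) * (Real.log ℓ + Real.log 2 + K) + K := by
          gcongr
          exact add_nonneg (Real.log_nonneg (by linarith [(Nat.cast_nonneg r : (0 : ℝ) ≤ r)])) hK
      _ = (Real.log ℓ / (ℓ : ℝ) ^ η + (Real.log 2 + K) * (ℓ : ℝ) ^ (-η) + K * (ℓ : ℝ)⁻¹) * ℓ := by
          rw [Real.rpow_sub hℓ0, Real.rpow_one, Real.rpow_neg hℓ0.le]
          field_simp
          ring
      _ ≤ η * ℓ := by
          gcongr
          exact hℓ.le

/-- Asymptotic lower bound for the dimension of `polylogSpan (1 / z) ℓ`. -/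
theorem eventually_le_finrank_polylogSpan {z : ℚ} (hz : 1 < |z|) {ε : ℝ} (hε : 0 < ε) :
    ∀ᶠ ℓ : ℕ in Filter.atTop, (1 - ε) / (1 + Real.log 2) * Real.log ℓ ≤
      Module.finrank ℚ (polylogSpan (1 / (z : ℝ)) ℓ) := by
  have hs : 1 < 1 + Real.log 2 := by linarith [Real.log_pos one_lt_two]
  rcases le_or_gt 1 ε with hε1 | hε1
  · refine Filter.Eventually.of_forall fun ℓ => le_trans ?_ (Nat.cast_nonneg _)
    exact mul_nonpos_of_nonpos_of_nonneg
      (div_nonpos_of_nonpos_of_nonneg (by linarith) (by linarith)) (Real.log_natCast_nonneg ℓ)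
  obtain ⟨K, hK, h⟩ := exists_mul_log_le_finrank_polylogSpan hz
  have hη : 0 < ε / 3 := by positivity
  have hlog := (Real.tendsto_log_atTop.comp
    (tendsto_natCast_atTop_atTop (R := ℝ))).eventually_ge_atTop (6 / ε)
  filter_upwards [eventually_exists_floor_rpow (half_pos hη) (by linarith) hK, hlog,
    Filter.eventually_ge_atTop 1] with ℓ ⟨r, hr, hrℓ, hT, hsmall⟩ hL hℓ1
  have hmain := h (ε / 3 / 2) (half_pos hη) r ℓ hr hrℓ
  simp only [Function.comp_apply] at hL
  have hℓ0 : (0 : ℝ) < ℓ := by exact_mod_cast hℓ1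
  set D : ℝ := (Module.finrank ℚ (polylogSpan (1 / (z : ℝ)) ℓ) : ℝ) with hD
  set L := Real.log (ℓ : ℝ) with hL_def
  have hD0 : 0 ≤ D := Nat.cast_nonneg _
  have hkey : (1 - ε / 3) * L ≤ D * ((1 + Real.log 2) * (1 + ε / 3)) + (1 + ε / 3) := by
    refine le_of_mul_le_mul_left ?_ hℓ0
    have hL0 : 0 < L := lt_of_lt_of_le (by positivity) hL
    have h1 : (ℓ : ℝ) * ((1 - ε / 3) * L) ≤ ℓ * Real.log (r + 1) := by
      refine mul_le_mul_of_nonneg_left ?_ hℓ0.le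
      nlinarith
    have h2 : ℓ * (1 + ε / 3 / 2 + Real.log 2) + (r * (Real.log (r + 1) + K) + K) ≤
        ℓ * ((1 + Real.log 2) * (1 + ε / 3)) := by
      have : 0 ≤ ℓ * (Real.log 2 * (ε / 3)) := by
        have := Real.log_nonneg one_le_two
        positivity
      linarith
    have h3 := mul_le_mul_of_nonneg_left h2 hD0
    linarith
  rw [div_mul_eq_mul_div, div_le_iff₀ (by linarith)]
  by_contra! hcon
  have h4 : 6 ≤ L * ε := (div_le_iff₀ hε).1 hL
  have h5 : (D * (1 + Real.log 2)) * (1 + ε / 3) < (1 - ε) * L * (1 + ε / 3) :=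
    mul_lt_mul_of_pos_right hcon (by linarith)
  nlinarith [mul_nonneg (by linarith : (0 : ℝ) ≤ L * ε) hε.le]

lemma infinite_setOf_irrational_Li {z : ℚ} (hz : 1 < |z|) :
    {j : ℕ | Irrational (Li j (1 / (z : ℝ)))}.Infinite := by
  intro hfin
  set w : ℝ := 1 / (z : ℝ) with hw
  let S : Set ℝ := {1} ∪ (fun j => Li j w) '' {j : ℕ | Irrational (Li j w)}
  have hS : S.Finite := (Set.finite_singleton _).union (hfin.image _)
  have : FiniteDimensional ℚ (Submodule.span ℚ S) := FiniteDimensional.span_of_finite ℚ hS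
  have hle (ℓ : ℕ) : polylogSpan w ℓ ≤ Submodule.span ℚ S := by
    refine Submodule.span_le.2 ?_
    rintro x (rfl | ⟨j, _, _, rfl⟩)
    · exact Submodule.subset_span (Or.inl rfl)
    · by_cases hj : Irrational (Li j w)
      · exact Submodule.subset_span (Or.inr ⟨j, hj, rfl⟩)
      · obtain ⟨y, hy⟩ := not_not.1 hj
        rw [← hy]
        have h1 : (1 : ℝ) ∈ Submodule.span ℚ S := Submodule.subset_span (Or.inl rfl)
        simpa [Rat.smul_def] using Submodule.smul_mem _ y h1
  have hs : 0 < 1 + Real.log 2 := by linarith [Real.log_pos one_lt_two]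
  have ht : Filter.Tendsto (fun ℓ : ℕ => (1 - 1 / 2 : ℝ) / (1 + Real.log 2) * Real.log ℓ)
      Filter.atTop Filter.atTop :=
    (Real.tendsto_log_atTop.comp tendsto_natCast_atTop_atTop).const_mul_atTop
      (div_pos (by norm_num) hs)
  obtain ⟨ℓ, h1, h2⟩ := ((eventually_le_finrank_polylogSpan hz one_half_pos).and
    (ht.eventually_gt_atTop (Module.finrank ℚ (Submodule.span ℚ S) : ℝ))).exists
  have h3 : (Module.finrank ℚ (polylogSpan w ℓ) : ℝ) ≤ Module.finrank ℚ (Submodule.span ℚ S) := by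
    exact_mod_cast Submodule.finrank_mono (hle ℓ)
  linarith

/-- (Rivoal) For every rational `z` with `|z| > 1` and every `ε > 0` there is `ℓ₀`
such that for all `ℓ ≥ ℓ₀` the dimension of the ℚ-span of
`1, Li₁(1/z), …, Li_ℓ(1/z)` is at least `(1-ε)/(1+log 2) · log ℓ`; in particular
`Li_j(1/z)` is irrational for infinitely many `j`. -/
theorem rivoal_polylog (z : ℚ) (hz : 1 < |z|) (ε : ℝ) (hε : 0 < ε) :
    (∃ ℓ₀ : ℕ, ∀ ℓ : ℕ, ℓ₀ ≤ ℓ →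
      (1 - ε) / (1 + Real.log 2) * Real.log ℓ ≤
        (Module.finrank ℚ
          (Submodule.span ℚ
            (({1} : Set ℝ) ∪
              {x : ℝ | ∃ j : ℕ, 1 ≤ j ∧ j ≤ ℓ ∧ x = Li j (1 / (z : ℝ))})) : ℝ)) ∧
    {j : ℕ | Irrational (Li j (1 / (z : ℝ)))}.Infinite := by
  refine ⟨?_, infinite_setOf_irrational_Li hz⟩
  exact Filter.eventually_atTop.1 (eventually_le_finrank_polylogSpan hz hε)
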